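/- Let G=(V,E) be a supply graph and H=(V,D) a demand graph such that the multigraph G+H is planar. Then the minimum cardinality of a multicut is at most 64 times the maximum cardinality of an integer multiflow. -/

import Mathlib

open scoped Classical

noncomputable section

/-- The edge set of a simple closed walk in the multigraph with endpoint map `ends`. -/
def IsCycle {V ε : Type} (ends : ε → Sym2 V) (C : Finset ε) : Prop :=
  ∃ (n : ℕ) (v : Fin (n + 1) → V) (e : Fin (n + 1) → ε),
    Function.Injective v ∧ Function.Injective e ∧
    (∀ i, ends (e i) = s(v i, v (i + 1))) ∧
    C = Finset.image e Finset.univ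

/-- The edge set of a simple (open) path. -/
def IsPath {V ε : Type} (ends : ε → Sym2 V) (P : Finset ε) : Prop :=
  ∃ (n : ℕ) (v : Fin (n + 1) → V) (e : Fin n → ε),
    Function.Injective v ∧ Function.Injective e ∧
    (∀ i : Fin n, ends (e i) = s(v i.castSucc, v i.succ)) ∧
    P = Finset.image e Finset.univ

/-- The cut `δ(U)`: edges with exactly one endpoint in `U`. -/
def cutF {V ε : Type} [Fintype ε] (ends : ε → Sym2 V) (U : Set V) : Finset ε :=
  Finset.univ.filter (fun e => ∃ a b, ends e = s(a, b) ∧ a ∈ U ∧ b ∉ U)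

/-- `U` is nonempty and induces a connected subgraph. -/
def ConnectedOn {V ε : Type} (ends : ε → Sym2 V) (U : Set V) : Prop :=
  U.Nonempty ∧ ∀ a ∈ U, ∀ b ∈ U,
    Relation.ReflTransGen (fun x y => x ∈ U ∧ y ∈ U ∧ ∃ e, ends e = s(x, y)) a b

/-- The multigraph is connected. -/
def MGConnected {V ε : Type} (ends : ε → Sym2 V) : Prop :=
  ConnectedOn ends Set.univ

/-- `δ(U)` is a simple cut: both sides induce connected subgraphs. -/
def IsSimpleCut {V ε : Type} (ends : ε → Sym2 V) (U : Set V) : Prop :=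
  ConnectedOn ends U ∧ ConnectedOn ends Uᶜ

/-- A `D`-cycle: a cycle containing exactly one demand edge. -/
def IsDCycle {V ε : Type} [DecidableEq ε] (ends : ε → Sym2 V) (Dem : Finset ε)
    (C : Finset ε) : Prop :=
  IsCycle ends C ∧ (C ∩ Dem).card = 1

/-- A `D`-cut: a simple cut containing exactly one demand edge. -/
def IsDCut {V ε : Type} [Fintype ε] [DecidableEq ε] (ends : ε → Sym2 V) (Dem : Finset ε)
    (U : Set V) : Prop :=
  IsSimpleCut ends U ∧ (cutF ends U ∩ Dem).card = 1

/-- Planarity of a multigraph: there is a drawing in the plane with injective vertex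
positions and arcs for the edges that are internally disjoint. -/
def IsPlanar {V ε : Type} (ends : ε → Sym2 V) : Prop :=
  ∃ (pos : V → ℝ × ℝ) (arc : ε → ℝ → ℝ × ℝ),
    Function.Injective pos ∧
    (∀ e, ContinuousOn (arc e) (Set.Icc 0 1)) ∧
    (∀ e a b, ends e = s(a, b) →
      (arc e 0 = pos a ∧ arc e 1 = pos b) ∨ (arc e 0 = pos b ∧ arc e 1 = pos a)) ∧
    (∀ e, Set.InjOn (arc e) (Set.Ico 0 1)) ∧
    (∀ e f, e ≠ f → ∀ s ∈ Set.Ioo (0:ℝ) 1, ∀ t ∈ Set.Icc (0:ℝ) 1, arc e s ≠ arc f t) ∧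
    (∀ e, ∀ s ∈ Set.Ioo (0:ℝ) 1, ∀ w, arc e s ≠ pos w)

/-- `f` has a continuous logarithm on `K`. -/
def HasLogOn (f : ℂ → ℂ) (K : Set ℂ) : Prop :=
  ∃ g : ℂ → ℂ, ContinuousOn g K ∧ ∀ z ∈ K, Complex.exp (g z) = f z

theorem HasLogOn.mono {f : ℂ → ℂ} {K L : Set ℂ} (h : HasLogOn f L) (hKL : K ⊆ L) :
    HasLogOn f K :=
  h.imp fun _ hg => ⟨hg.1.mono hKL, fun z hz => hg.2 z (hKL hz)⟩

theorem HasLogOn.congr {f f' : ℂ → ℂ} {K : Set ℂ} (h : HasLogOn f K)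
    (hff : ∀ z ∈ K, f z = f' z) : HasLogOn f' K :=
  h.imp fun _ hg => ⟨hg.1, fun z hz => (hg.2 z hz).trans (hff z hz)⟩

theorem HasLogOn.inv {f : ℂ → ℂ} {K : Set ℂ} (h : HasLogOn f K) :
    HasLogOn (fun z => (f z)⁻¹) K := by
  obtain ⟨g, hg, hgf⟩ := h
  exact ⟨fun z => -g z, hg.neg, fun z hz => by rw [Complex.exp_neg, hgf z hz]⟩

/-- Homotopy lifting for the exponential. -/
theorem exists_log_of_homotopy {A : Type*} [TopologicalSpace A] (H : C(unitInterval × A, ℂ))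
    (hH : ∀ x, H x ≠ 0) (f : C(A, ℂ)) (h0 : ∀ a, Complex.exp (f a) = H (0, a)) :
    ∃ g : C(A, ℂ), ∀ a, Complex.exp (g a) = H (1, a) := by
  let H' : C(unitInterval × A, {z : ℂ // z ≠ 0}) := ⟨fun x => ⟨H x, hH x⟩, by fun_prop⟩
  have h0' : ∀ a, H' (0, a) = (⟨_, (f a).exp_ne_zero⟩ : {z : ℂ // z ≠ 0}) := fun a =>
    Subtype.ext (h0 a).symm
  let G := Complex.isCoveringMap_exp.liftHomotopy H' f h0'
  refine ⟨⟨fun a => G (1, a), by fun_prop⟩, fun a => ?_⟩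
  have := congrFun (Complex.isCoveringMap_exp.liftHomotopy_lifts H' f h0') (1, a)
  exact congrArg Subtype.val this

theorem hasLogOn_of_restrict {f : ℂ → ℂ} {K : Set ℂ} (g : C(K, ℂ))
    (hg : ∀ z : K, Complex.exp (g z) = f z) : HasLogOn f K := by
  refine ⟨fun z => if h : z ∈ K then g ⟨z, h⟩ else 0, ?_, fun z hz => by simp [hz, hg]⟩
  rw [continuousOn_iff_continuous_domRestrict]
  convert! g.continuous with z
  simp

theorem hasLogOn_of_joinedIn {K : Set ℂ} {p q : ℂ} (h : JoinedIn Kᶜ p q) :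
    HasLogOn (fun z => (z - p) / (z - q)) K := by
  obtain ⟨γ, hγ⟩ := h.symm
  have hne : ∀ (t : unitInterval) (z : K), (z : ℂ) - γ t ≠ 0 := fun t z hz =>
    hγ t (by rw [← sub_eq_zero.1 hz]; exact z.2)
  have hq : ∀ z : K, (z : ℂ) - q ≠ 0 := fun z => by simpa using hne 0 z
  let H : C(unitInterval × K, ℂ) := ⟨fun x => ((x.2 : ℂ) - γ x.1) / (x.2 - q), by
    refine Continuous.div (by fun_prop) (by fun_prop) fun x => hq x.2⟩
  obtain ⟨g, hg⟩ := exists_log_of_homotopy H (fun x => div_ne_zero (hne _ _) (hq _))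
    (ContinuousMap.const _ 0) (fun a => by simp [H, hq])
  exact hasLogOn_of_restrict g fun z => by rw [hg]; simp [H]

theorem log_sub_log_eq {X : Type*} [TopologicalSpace X] [PreconnectedSpace X] {g h : X → ℂ}
    (hg : Continuous g) (hh : Continuous h) (hgh : ∀ x, Complex.exp (g x) = Complex.exp (h x))
    (x y : X) : g x - h x = g y - h y := by
  have hx : Complex.exp (g x - h x) = 1 := by
    rw [Complex.exp_sub, hgh, div_self (Complex.exp_ne_zero _)]
  have := Complex.isCoveringMap_exp.eq_of_comp_eq hg
    (show Continuous fun y => h y + (g x - h x) by fun_prop)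
    (by funext y; exact Subtype.ext (by simp [Complex.exp_add, hx, hgh])) x (by ring)
  have := congrFun this y
  rw [this]; ring

theorem log_sub_log_eq_of_joinedIn {S : Set ℂ} {g h : ℂ → ℂ} (hg : ContinuousOn g S)
    (hh : ContinuousOn h S) (hgh : ∀ x ∈ S, Complex.exp (g x) = Complex.exp (h x)) {a b : ℂ}
    (hab : JoinedIn S a b) : g a - h a = g b - h b := by
  obtain ⟨γ, hγ⟩ := hab
  have := log_sub_log_eq (X := unitInterval) (g := g ∘ γ) (h := h ∘ γ)
    (hg.comp_continuous γ.continuous hγ) (hh.comp_continuous γ.continuous hγ)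
    (fun t => hgh _ (hγ t)) 0 1
  simpa using this

theorem zero_of_log_on_circle {n : ℤ} {g : ℝ → ℂ} (hg : Continuous g) {c : ℂ}
    (h : ∀ t : ℝ, Complex.exp (g t) = c * Complex.exp (n * t * Complex.I))
    (hper : g (2 * Real.pi) = g 0) : n = 0 := by
  have hc : Complex.exp (g 0) = c := by simpa using h 0
  have := log_sub_log_eq (X := ℝ) hg (h := fun t : ℝ => g 0 + n * t * Complex.I) (by fun_prop)
    (fun t => by rw [h, Complex.exp_add, hc]) 0 (2 * Real.pi)
  simp [hper] at this
  exact this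

theorem exists_log_of_ne_zero {F : ℂ → ℂ} (hF : Continuous F) (h0 : ∀ z, F z ≠ 0) :
    ∃ g : ℂ → ℂ, Continuous g ∧ ∀ z, Complex.exp (g z) = F z := by
  let H : C(unitInterval × ℂ, ℂ) := ⟨fun x => F ((x.1 : ℝ) * x.2), by fun_prop⟩
  obtain ⟨g, hg⟩ := exists_log_of_homotopy H (fun x => h0 _)
    (ContinuousMap.const _ (Complex.log (F 0))) (fun a => by simp [H, Complex.exp_log (h0 0)])
  exact ⟨g, g.continuous, fun z => by rw [hg]; simp [H]⟩

theorem exponent_eq_zero {K : Set ℂ} (hK : IsCompact K) {p : ℂ} (hp : p ∉ K) {n : ℤ} {u : ℂ → ℂ}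
    (hbdd : Bornology.IsBounded (pathComponentIn Kᶜ p))
    (hu : ContinuousOn u (K ∪ pathComponentIn Kᶜ p)) (hu0 : ∀ z ∈ K ∪ pathComponentIn Kᶜ p, u z ≠ 0)
    (hlog : HasLogOn (fun z => (z - p) ^ n * u z) K) : n = 0 := by
  set U := pathComponentIn Kᶜ p with hU
  have hUo : IsOpen U := hK.isClosed.isOpen_compl.pathComponentIn p
  have hpU : p ∈ U := mem_pathComponentIn_self hp
  have hcl : closure U ⊆ K ∪ U := by
    intro z hz
    by_contra hzn
    simp only [Set.mem_union, not_or] at hzn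
    have hVo : IsOpen (pathComponentIn Kᶜ z) := hK.isClosed.isOpen_compl.pathComponentIn z
    obtain ⟨w, hwz, hwU⟩ := mem_closure_iff.1 hz _ hVo (mem_pathComponentIn_self hzn.1)
    exact hzn.2 (JoinedIn.trans hwU hwz.symm)
  obtain ⟨g, hg, hgf⟩ := hlog
  obtain ⟨G, hG⟩ := ContinuousMap.exists_restrict_eq hK.isClosed
    ⟨K.domRestrict g, continuousOn_iff_continuous_domRestrict.1 hg⟩
  have hGg : ∀ z ∈ K, G z = g z := fun z hz => congrArg (fun f => f ⟨z, hz⟩) hG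
  let F : ℂ → ℂ := fun z => if z ∈ U then Complex.exp (G z) / u z else (z - p) ^ n
  have hFc : Continuous F := by
    refine continuous_if (fun z hz => ?_) ?_ ?_
    · have hzU : z ∉ U := fun h => (hUo.frontier_eq ▸ hz).2 h
      have hzK : z ∈ K := (hcl (frontier_subset_closure hz)).resolve_right hzU
      rw [hGg z hzK, hgf z hzK, mul_div_cancel_right₀ _ (hu0 z (Or.inl hzK))]
    · exact ContinuousOn.div (by fun_prop) (hu.mono hcl) fun z hz => hu0 z (hcl hz)
    · have : closure {z | z ∉ U} = Uᶜ := hUo.isClosed_compl.closure_eq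
      rw [this]
      exact ContinuousOn.zpow₀ (by fun_prop) n fun z hz =>
        Or.inl (sub_ne_zero.2 fun h => hz (h ▸ hpU))
  have hF0 : ∀ z, F z ≠ 0 := by
    intro z
    by_cases hz : z ∈ U
    · simpa [F, hz] using hu0 z (Or.inr hz)
    · have : z - p ≠ 0 := sub_ne_zero.2 fun h => hz (h ▸ hpU)
      simpa [F, hz] using zpow_ne_zero n this
  obtain ⟨l, hl, hlF⟩ := exists_log_of_ne_zero hFc hF0
  obtain ⟨r, hr0, hr⟩ := hbdd.subset_ball_lt 0 p
  refine zero_of_log_on_circle (g := fun t : ℝ => l (p + r * Complex.exp (t * Complex.I)))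
    (c := (r : ℂ) ^ n) (by fun_prop) (fun t => ?_) ?_
  · have hz : p + r * Complex.exp (t * Complex.I) ∉ U := fun h => by
      have := hr h
      simp [Complex.norm_exp_ofReal_mul_I, abs_of_pos hr0] at this
    simp only [hlF, F, hz, if_false, add_sub_cancel_left, mul_zpow,
      ← Complex.exp_int_mul, mul_assoc]
  · simp

theorem exists_radius_joinedIn_compl {K : Set ℂ} (hK : Bornology.IsBounded K) :
    ∃ r : ℝ, ∀ z w : ℂ, r ≤ ‖z‖ → r ≤ ‖w‖ → JoinedIn Kᶜ z w := by
  obtain ⟨r, hr0, hr⟩ := hK.subset_ball_lt 0 0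
  have hpc : IsPathConnected ((fun x : ℝ × ℝ => (x.1 : ℂ) * Complex.exp (x.2 * Complex.I)) ''
      (Set.Ici r ×ˢ Set.univ)) := by
    refine IsPathConnected.image ?_ (by fun_prop)
    exact ((convex_Ici r).prod convex_univ).isPathConnected ⟨(r, 0), by simp⟩
  refine ⟨r, fun z w hz hw => ?_⟩
  refine (hpc.joinedIn z ⟨(‖z‖, z.arg), by simpa using hz, by simp⟩ w
    ⟨(‖w‖, w.arg), by simpa using hw, by simp⟩).mono ?_
  rintro _ ⟨⟨s, t⟩, ⟨hs, -⟩, rfl⟩ h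
  have := hr h
  simp [Complex.norm_exp_ofReal_mul_I] at this
  exact absurd (le_abs_self s) (not_le.2 (this.trans_le hs))

theorem isBounded_pathComponentIn_or {K : Set ℂ} (hK : Bornology.IsBounded K) {p q : ℂ}
    (h : ¬ JoinedIn Kᶜ p q) : Bornology.IsBounded (pathComponentIn Kᶜ p) ∨
      Bornology.IsBounded (pathComponentIn Kᶜ q) := by
  obtain ⟨r, hr⟩ := exists_radius_joinedIn_compl hK
  by_contra! hcon
  have key : ∀ p, ¬ Bornology.IsBounded (pathComponentIn Kᶜ p) →
      ∃ z ∈ pathComponentIn Kᶜ p, r ≤ ‖z‖ := by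
    intro p hp
    by_contra! hb
    exact hp ((Metric.isBounded_ball (x := (0 : ℂ)) (r := r)).subset fun z hz => by
      simpa using hb z hz)
  obtain ⟨z, hz, hzr⟩ := key p hcon.1
  obtain ⟨w, hw, hwr⟩ := key q hcon.2
  exact h ((JoinedIn.trans hz (hr z w hzr hwr)).trans (JoinedIn.symm hw))

/-- Three points in distinct components of the complement are multiplicatively independent. -/
theorem exponents_eq_zero {K : Set ℂ} (hK : IsCompact K) {p q r : ℂ} (hp : p ∉ K) (hq : q ∉ K)
    (hr : r ∉ K) (hpq : ¬ JoinedIn Kᶜ p q) (hpr : ¬ JoinedIn Kᶜ p r)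
    {a b c : ℤ} (hbdd : Bornology.IsBounded (pathComponentIn Kᶜ p))
    (hlog : HasLogOn (fun z => (z - p) ^ a * (z - q) ^ b * (z - r) ^ c) K) : a = 0 := by
  have hne : ∀ s, s ∉ K → ¬ JoinedIn Kᶜ p s → ∀ z ∈ K ∪ pathComponentIn Kᶜ p, z - s ≠ 0 := by
    rintro s hs hps z (hz | hz) h
    · exact hs (sub_eq_zero.1 h ▸ hz)
    · exact hps (sub_eq_zero.1 h ▸ hz)
  refine exponent_eq_zero hK hp (u := fun z => (z - q) ^ b * (z - r) ^ c) hbdd ?_ ?_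
    (hlog.congr fun z _ => by ring)
  · exact (ContinuousOn.zpow₀ (by fun_prop) b fun z hz => Or.inl (hne q hq hpq z hz)).mul
      (ContinuousOn.zpow₀ (by fun_prop) c fun z hz => Or.inl (hne r hr hpr z hz))
  · exact fun z hz => mul_ne_zero (zpow_ne_zero _ (hne q hq hpq z hz))
      (zpow_ne_zero _ (hne r hr hpr z hz))

/-- Eilenberg's criterion. -/
theorem joinedIn_of_hasLogOn {K : Set ℂ} (hK : IsCompact K) {p q : ℂ} (hp : p ∉ K) (hq : q ∉ K)
    (hlog : HasLogOn (fun z => (z - p) / (z - q)) K) : JoinedIn Kᶜ p q := by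
  by_contra h
  rcases isBounded_pathComponentIn_or hK.isBounded h with hb | hb
  · have := exponents_eq_zero hK hp hq hq h h (a := 1) (b := -1) (c := 0) hb
      (hlog.congr fun z _ => by simp [div_eq_mul_inv])
    simp at this
  · have h' : ¬ JoinedIn Kᶜ q p := fun h' => h h'.symm
    have := exponents_eq_zero hK hq hp hp h' h' (a := 1) (b := -1) (c := 0) hb
      (hlog.inv.congr fun z _ => by simp [div_eq_mul_inv])
    simp at this

/-- Among three points in distinct components, there is no nontrivial relation
of total degree zero. -/
theorem no_relation {K : Set ℂ} (hK : IsCompact K) {p q r : ℂ} (hp : p ∉ K) (hq : q ∉ K)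
    (hr : r ∉ K) (hpq : ¬ JoinedIn Kᶜ p q) (hpr : ¬ JoinedIn Kᶜ p r) (hqr : ¬ JoinedIn Kᶜ q r)
    {a b c : ℤ} (ha : a ≠ 0) (hb : b ≠ 0)
    (hlog : HasLogOn (fun z => (z - p) ^ a * (z - q) ^ b * (z - r) ^ c) K) : False := by
  rcases isBounded_pathComponentIn_or hK.isBounded hpq with h | h
  · exact ha (exponents_eq_zero hK hp hq hr hpq hpr h hlog)
  · exact hb (exponents_eq_zero hK hq hp hr (fun h' => hpq h'.symm) hqr h
      (hlog.congr fun z _ => by ring))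

/-- `γ` restricted to the unit interval is an arc (or a closed arc) attached to `K` exactly at its
end points. -/
structure IsEar (K : Set ℂ) (γ : ℝ → ℂ) : Prop where
  cont : ContinuousOn γ (Set.Icc 0 1)
  inj : Set.InjOn γ (Set.Ioo 0 1)
  zero_mem : γ 0 ∈ K
  one_mem : γ 1 ∈ K
  notMem : ∀ t ∈ Set.Ioo (0 : ℝ) 1, γ t ∉ K

/-- The image of the unit interval. -/
def trace (γ : ℝ → ℂ) : Set ℂ := γ '' Set.Icc 0 1

theorem isCompact_trace {γ : ℝ → ℂ} (hγ : ContinuousOn γ (Set.Icc 0 1)) : IsCompact (trace γ) :=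
  isCompact_Icc.image_of_continuousOn hγ

/-- `f` has logarithms on `K` and along `γ` whose mismatch is `n` turns. -/
def EarLog (f : ℂ → ℂ) (K : Set ℂ) (γ : ℝ → ℂ) (n : ℤ) : Prop :=
  ∃ (g : ℂ → ℂ) (h : ℝ → ℂ), ContinuousOn g K ∧ (∀ z ∈ K, Complex.exp (g z) = f z) ∧
    ContinuousOn h (Set.Icc 0 1) ∧ (∀ t ∈ Set.Icc (0 : ℝ) 1, Complex.exp (h t) = f (γ t)) ∧
    h 0 = g (γ 0) ∧ h 1 = g (γ 1) + n * (2 * Real.pi * Complex.I)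

theorem exists_log_along {f : ℂ → ℂ} {γ : ℝ → ℂ} (hγ : ContinuousOn γ (Set.Icc 0 1))
    (hf : ContinuousOn f (trace γ)) (hf0 : ∀ z ∈ trace γ, f z ≠ 0) :
    ∃ h : ℝ → ℂ, ContinuousOn h (Set.Icc 0 1) ∧
      ∀ t ∈ Set.Icc (0 : ℝ) 1, Complex.exp (h t) = f (γ t) := by
  have hfγ : Continuous fun t : unitInterval => f (γ t) :=
    (hf.comp hγ fun t ht => ⟨t, ht, rfl⟩).domRestrict
  let H : C(unitInterval × unitInterval, ℂ) := ⟨fun x => f (γ (x.1 * x.2 : unitInterval)),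
    hfγ.comp (g := fun t : unitInterval => f (γ t)) (by fun_prop)⟩
  have h0 : ∀ t : unitInterval, f (γ t) ≠ 0 := fun t => hf0 _ ⟨t, t.2, rfl⟩
  obtain ⟨g, hg⟩ := exists_log_of_homotopy H (fun x => h0 _)
    (ContinuousMap.const _ (Complex.log (f (γ 0)))) (fun a => by
      have := h0 0
      simp only [Set.Icc.coe_zero] at this
      simp [H, Complex.exp_log this])
  refine ⟨Set.IccExtend zero_le_one g, (g.continuous.Icc_extend' (h := zero_le_one)).continuousOn,
    fun t ht => ?_⟩
  rw [Set.IccExtend_of_mem _ _ ht, hg]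
  simp [H]

theorem EarLog.exists {f : ℂ → ℂ} {K : Set ℂ} {γ : ℝ → ℂ} (he : IsEar K γ)
    (hf : ContinuousOn f (trace γ)) (hf0 : ∀ z ∈ trace γ, f z ≠ 0) (hlog : HasLogOn f K) :
    ∃ n, EarLog f K γ n := by
  obtain ⟨g, hg, hgf⟩ := hlog
  obtain ⟨h, hh, hhf⟩ := exists_log_along he.cont hf hf0
  have h0 : (0 : ℝ) ∈ Set.Icc (0 : ℝ) 1 := by simp
  have h1 : (1 : ℝ) ∈ Set.Icc (0 : ℝ) 1 := by simp
  have e0 : Complex.exp (g (γ 0) - h 0) = 1 := by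
    rw [Complex.exp_sub, hgf _ he.zero_mem, hhf 0 h0, div_self (hf0 _ ⟨0, h0, rfl⟩)]
  have e1 : Complex.exp (h 1 + (g (γ 0) - h 0)) = Complex.exp (g (γ 1)) := by
    rw [Complex.exp_add, e0, hgf _ he.one_mem, hhf 1 h1, mul_one]
  obtain ⟨n, hn⟩ := Complex.exp_eq_exp_iff_exists_int.1 e1
  exact ⟨n, g, fun t => h t + (g (γ 0) - h 0), hg, hgf, hh.add continuousOn_const,
    fun t ht => by rw [Complex.exp_add, e0, hhf t ht, mul_one], by ring, hn⟩

theorem continuousOn_trace {γ : ℝ → ℂ} (hγ : ContinuousOn γ (Set.Icc 0 1)) {G : ℂ → ℂ}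
    (hG : ContinuousOn (fun t => G (γ t)) (Set.Icc 0 1)) : ContinuousOn G (trace γ) := by
  let π : Set.Icc (0 : ℝ) 1 → trace γ := fun t => ⟨γ t, t, t.2, rfl⟩
  have hπ : Continuous π := (continuousOn_iff_continuous_domRestrict.1 hγ).subtype_mk _
  have hs : Function.Surjective π := by
    rintro ⟨_, t, ht, rfl⟩
    exact ⟨⟨t, ht⟩, rfl⟩
  have hq := Topology.IsQuotientMap.of_surjective_continuous hs hπ
  rw [continuousOn_iff_continuous_domRestrict, hq.continuous_iff]
  exact continuousOn_iff_continuous_domRestrict.1 hG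

theorem EarLog.hasLogOn {f : ℂ → ℂ} {K : Set ℂ} {γ : ℝ → ℂ} (hK : IsClosed K) (he : IsEar K γ)
    (h : EarLog f K γ 0) : HasLogOn f (K ∪ trace γ) := by
  obtain ⟨g, h, hg, hgf, hh, hhf, h0, h1⟩ := h
  let G : ℂ → ℂ := fun z => if z ∈ K then g z else h (Function.invFunOn γ (Set.Ioo 0 1) z)
  have hGK : ∀ z ∈ K, G z = g z := fun z hz => by simp [G, hz]
  have hGγ : ∀ t ∈ Set.Icc (0 : ℝ) 1, G (γ t) = h t := by
    intro t ht
    rcases eq_or_lt_of_le ht.1 with rfl | ht0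
    · rw [hGK _ he.zero_mem, h0]
    rcases eq_or_lt_of_le ht.2 with rfl | ht1
    · rw [hGK _ he.one_mem, h1]; simp
    · have : γ t ∉ K := he.notMem t ⟨ht0, ht1⟩
      simp only [G, this, if_false]
      rw [he.inj.leftInvOn_invFunOn ⟨ht0, ht1⟩]
  refine ⟨G, ContinuousOn.union_of_isClosed (hg.congr hGK) ?_ hK
    (isCompact_trace he.cont).isClosed, ?_⟩
  · exact continuousOn_trace he.cont (hh.congr hGγ)
  · rintro z (hz | ⟨t, ht, rfl⟩)
    · rw [hGK z hz, hgf z hz]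
    · rw [hGγ t ht, hhf t ht]

theorem EarLog.zpow_mul_zpow {f f' : ℂ → ℂ} {K : Set ℂ} {γ : ℝ → ℂ} {n m : ℤ}
    (h : EarLog f K γ n) (h' : EarLog f' K γ m) (a b : ℤ) :
    EarLog (fun z => f z ^ a * f' z ^ b) K γ (a * n + b * m) := by
  obtain ⟨g, h, hg, hgf, hh, hhf, h0, h1⟩ := h
  obtain ⟨g', h', hg', hgf', hh', hhf', h0', h1'⟩ := h'
  refine ⟨fun z => a * g z + b * g' z, fun t => a * h t + b * h' t, by fun_prop, fun z hz => ?_,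
    by fun_prop, fun t ht => ?_, by simp only [h0, h0'], ?_⟩
  · rw [Complex.exp_add, Complex.exp_int_mul, Complex.exp_int_mul, hgf z hz, hgf' z hz]
  · rw [Complex.exp_add, Complex.exp_int_mul, Complex.exp_int_mul, hhf t ht, hhf' t ht]
  · simp only [h1, h1']
    push_cast
    ring

theorem continuousOn_sub_div_sub {L : Set ℂ} {p q : ℂ} (hq : q ∉ L) :
    ContinuousOn (fun z => (z - p) / (z - q)) L :=
  ContinuousOn.div (by fun_prop) (by fun_prop) fun _ hz h => hq (sub_eq_zero.1 h ▸ hz)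

theorem sub_div_sub_ne_zero {L : Set ℂ} {p q : ℂ} (hp : p ∉ L) (hq : q ∉ L) :
    ∀ z ∈ L, (z - p) / (z - q) ≠ 0 := fun _ hz =>
  div_ne_zero (fun h => hp (sub_eq_zero.1 h ▸ hz)) (fun h => hq (sub_eq_zero.1 h ▸ hz))

theorem EarLog.exists_of_joinedIn {K : Set ℂ} {γ : ℝ → ℂ} (he : IsEar K γ) {p q : ℂ}
    (hp : p ∉ K ∪ trace γ) (hq : q ∉ K ∪ trace γ) (hpq : JoinedIn Kᶜ p q) :
    ∃ n, EarLog (fun z => (z - p) / (z - q)) K γ n :=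
  EarLog.exists he (continuousOn_sub_div_sub fun h => hq (Or.inr h))
    (sub_div_sub_ne_zero (fun h => hp (Or.inr h)) fun h => hq (Or.inr h))
    (hasLogOn_of_joinedIn hpq)

/-- Attaching an ear splits a component of the complement into at most two pieces. -/
theorem IsEar.joinedIn_or {K : Set ℂ} {γ : ℝ → ℂ} (hK : IsCompact K) (he : IsEar K γ) {p q r : ℂ}
    (hp : p ∉ K ∪ trace γ) (hq : q ∉ K ∪ trace γ) (hr : r ∉ K ∪ trace γ)
    (hpq : JoinedIn Kᶜ p q) (hpr : JoinedIn Kᶜ p r) :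
    JoinedIn (K ∪ trace γ)ᶜ p q ∨ JoinedIn (K ∪ trace γ)ᶜ p r ∨ JoinedIn (K ∪ trace γ)ᶜ q r := by
  by_contra! hcon
  obtain ⟨h1, h2, h3⟩ := hcon
  have hKc := hK.union (isCompact_trace he.cont)
  obtain ⟨n, hn⟩ := EarLog.exists_of_joinedIn he hp hq hpq
  obtain ⟨m, hm⟩ := EarLog.exists_of_joinedIn he hp hr hpr
  have hn0 : n ≠ 0 := by
    rintro rfl
    exact h1 (joinedIn_of_hasLogOn hKc hp hq (hn.hasLogOn hK.isClosed he))
  have hm0 : m ≠ 0 := by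
    rintro rfl
    exact h2 (joinedIn_of_hasLogOn hKc hp hr (hm.hasLogOn hK.isClosed he))
  have := hn.zpow_mul_zpow hm m (-n)
  rw [show m * n + -n * m = 0 by ring] at this
  refine no_relation hKc hq hr hp h3 (fun h => h1 h.symm) (fun h => h2 h.symm) (a := -m) (b := n)
    (c := m - n) (neg_ne_zero.2 hm0) hn0 ((this.hasLogOn hK.isClosed he).congr fun z hz => ?_)
  have hzp : z - p ≠ 0 := fun h => hp (sub_eq_zero.1 h ▸ hz)
  simp only [div_zpow, zpow_neg, zpow_sub₀ hzp]
  field_simp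

/-- An arc attached to `K` at its starting point only. -/
structure IsLeafArc (K : Set ℂ) (γ : ℝ → ℂ) : Prop where
  cont : ContinuousOn γ (Set.Icc 0 1)
  inj : Set.InjOn γ (Set.Ioc 0 1)
  zero_mem : γ 0 ∈ K
  notMem : ∀ t ∈ Set.Ioc (0 : ℝ) 1, γ t ∉ K

theorem IsLeafArc.isEar {K : Set ℂ} {γ : ℝ → ℂ} (h : IsLeafArc K γ) : IsEar (K ∪ {γ 1}) γ where
  cont := h.cont
  inj := h.inj.mono Set.Ioo_subset_Ioc_self
  zero_mem := Or.inl h.zero_mem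
  one_mem := Or.inr rfl
  notMem := by
    rintro t ht (h' | h')
    · exact h.notMem t ⟨ht.1, ht.2.le⟩ h'
    · exact ht.2.ne (h.inj ⟨ht.1, ht.2.le⟩ ⟨one_pos, le_rfl⟩ h')

theorem IsLeafArc.union_eq {K : Set ℂ} {γ : ℝ → ℂ} : K ∪ {γ 1} ∪ trace γ = K ∪ trace γ := by
  rw [Set.union_assoc, Set.union_eq_self_of_subset_left (s := {γ 1})]
  rintro _ rfl
  exact ⟨1, by simp, rfl⟩

/-- Attaching a leaf arc does not split components of the complement. -/
theorem IsLeafArc.joinedIn {K : Set ℂ} {γ : ℝ → ℂ} (hK : IsCompact K) (he : IsLeafArc K γ) {p q : ℂ}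
    (hp : p ∉ K ∪ trace γ) (hq : q ∉ K ∪ trace γ) (hpq : JoinedIn Kᶜ p q) :
    JoinedIn (K ∪ trace γ)ᶜ p q := by
  have hKc := hK.union (isCompact_trace he.cont)
  obtain ⟨g, hg, hgf⟩ := hasLogOn_of_joinedIn hpq
  have hf0 := sub_div_sub_ne_zero (fun h => hp (Or.inr h)) fun h => hq (Or.inr h)
  obtain ⟨h, hh, hhf⟩ := exists_log_along he.cont
    (continuousOn_sub_div_sub (p := p) fun h => hq (Or.inr h)) hf0
  have h0 : (0 : ℝ) ∈ Set.Icc (0 : ℝ) 1 := by simp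
  have h1 : (1 : ℝ) ∈ Set.Icc (0 : ℝ) 1 := by simp
  have h1K : γ 1 ∉ K := he.notMem 1 (by simp)
  have e0 : Complex.exp (g (γ 0) - h 0) = 1 := by
    rw [Complex.exp_sub, hgf _ he.zero_mem, hhf 0 h0, div_self (hf0 _ ⟨0, h0, rfl⟩)]
  let g' : ℂ → ℂ := fun z => if z ∈ K then g z else h 1 + (g (γ 0) - h 0)
  have hg'K : ∀ z ∈ K, g' z = g z := fun z hz => by simp [g', hz]
  have hg'1 : g' (γ 1) = h 1 + (g (γ 0) - h 0) := by simp [g', h1K]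
  have key : EarLog (fun z => (z - p) / (z - q)) (K ∪ {γ 1}) γ 0 := by
    refine ⟨g', fun t => h t + (g (γ 0) - h 0), ?_, ?_, hh.add continuousOn_const,
      fun t ht => by rw [Complex.exp_add, e0, hhf t ht, mul_one], ?_, ?_⟩
    · exact ContinuousOn.union_of_isClosed (hg.congr hg'K) (continuousOn_singleton _ _)
        hK.isClosed isClosed_singleton
    · rintro z (hz | rfl)
      · rw [hg'K z hz, hgf z hz]
      · rw [hg'1, Complex.exp_add, e0, hhf 1 h1, mul_one]
    · rw [hg'K _ he.zero_mem]; ring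
    · rw [hg'1]; simp
  have := key.hasLogOn (hK.isClosed.union isClosed_singleton) he.isEar
  rw [IsLeafArc.union_eq] at this
  exact joinedIn_of_hasLogOn hKc hp hq this

theorem not_hasLogOn_compl_pair {a b : ℂ} (hab : a ≠ b) :
    ¬ HasLogOn (fun z => (z - a) / (z - b)) ({a, b} : Set ℂ)ᶜ := by
  intro h
  have hd : 0 < dist b a := dist_pos.2 hab.symm
  have ha : a ∉ Metric.sphere a (dist b a / 2) := by
    simp only [Metric.mem_sphere, dist_self]; intro h; linarith
  have hb : b ∉ Metric.sphere a (dist b a / 2) := by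
    simp only [Metric.mem_sphere]
    intro h
    linarith
  have hj := joinedIn_of_hasLogOn (isCompact_sphere a (dist b a / 2)) ha hb (h.mono (by
    intro z hz
    simp only [Set.mem_compl_iff, Set.mem_insert_iff, Set.mem_singleton_iff, not_or]
    exact ⟨fun h => ha (h ▸ hz), fun h => hb (h ▸ hz)⟩))
  obtain ⟨γ, hγ⟩ := hj
  obtain ⟨t, ht⟩ := mem_range_of_exists_le_of_exists_ge
    (show Continuous fun t => dist (γ t) a by fun_prop) (c := dist b a / 2)
    ⟨0, by simp; linarith⟩ ⟨1, by simp⟩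
  exact hγ t ht

/-- Points close to an interior point of an ear on a closed curve that are separated by
the closed curve. -/
theorem IsEar.exists_separated {K P : Set ℂ} {γ : ℝ → ℂ} (hK : IsClosed K) (he : IsEar K γ)
    (hPK : P ⊆ K) (hP : IsClosed P) (hj : JoinedIn P (γ 0) (γ 1)) :
    ∃ p q, p ∉ K ∪ trace γ ∧ q ∉ K ∪ trace γ ∧ JoinedIn Kᶜ p q ∧
      ¬ JoinedIn (P ∪ trace γ)ᶜ p q := by
  by_contra! hcon
  have hhalf : (1 / 2 : ℝ) ∈ Set.Ioo (0 : ℝ) 1 := by norm_num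
  obtain ⟨r, hr, hrK⟩ := Metric.isOpen_iff.1 hK.isOpen_compl _ (he.notMem _ hhalf)
  obtain ⟨δ, hδ, hδr⟩ := Metric.continuousOn_iff.1 he.cont _ (Set.Ioo_subset_Icc_self hhalf) r hr
  obtain ⟨η, hη0, hηδ, hη2⟩ : ∃ η : ℝ, 0 < η ∧ η < δ ∧ η < 1 / 2 :=
    ⟨min (δ / 2) (1 / 4), by positivity, by
      have := min_le_left (δ / 2) (1 / 4 : ℝ); linarith, by
      have := min_le_right (δ / 2) (1 / 4 : ℝ); linarith⟩
  set s := 1 / 2 - η with hs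
  set t := 1 / 2 + η with ht
  have hs0 : 0 < s := by linarith
  have hst : s < t := by linarith
  have ht1 : t < 1 := by linarith
  set W := Metric.ball (γ (1 / 2)) r with hW
  set A := γ '' Set.Icc s t with hA
  set B := P ∪ (γ '' Set.Icc 0 s ∪ γ '' Set.Icc t 1) with hB
  have hsub1 : Set.Icc s t ⊆ Set.Icc 0 1 := Set.Icc_subset_Icc hs0.le ht1.le
  have hsub2 : Set.Icc 0 s ⊆ Set.Icc 0 1 := Set.Icc_subset_Icc le_rfl (by linarith)
  have hsub3 : Set.Icc t 1 ⊆ Set.Icc 0 1 := Set.Icc_subset_Icc (by linarith) le_rfl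
  have hAW : A ⊆ W := by
    rintro _ ⟨x, hx, rfl⟩
    refine hδr x (hsub1 hx) (lt_of_le_of_lt ?_ hηδ)
    rw [Real.dist_eq, abs_le]
    constructor <;> linarith [hx.1, hx.2]
  have hAc : IsClosed A := (isCompact_Icc.image_of_continuousOn (he.cont.mono hsub1)).isClosed
  have hBc : IsClosed B := hP.union
    ((isCompact_Icc.image_of_continuousOn (he.cont.mono hsub2)).isClosed.union
      (isCompact_Icc.image_of_continuousOn (he.cont.mono hsub3)).isClosed)
  have hABu : A ∪ B = P ∪ trace γ := by
    have : trace γ = γ '' Set.Icc 0 s ∪ (γ '' Set.Icc s t ∪ γ '' Set.Icc t 1) := by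
      rw [← Set.image_union, ← Set.image_union, Set.Icc_union_Icc_eq_Icc hst.le ht1.le,
        Set.Icc_union_Icc_eq_Icc hs0.le (by linarith)]
      rfl
    rw [this, hA, hB]
    ext z
    simp only [Set.mem_union]
    tauto
  have hABi : A ∩ B ⊆ {γ s, γ t} := by
    rintro _ ⟨⟨x, hx, rfl⟩, hxB⟩
    have hx' : x ∈ Set.Ioo (0 : ℝ) 1 := ⟨hs0.trans_le hx.1, hx.2.trans_lt ht1⟩
    rcases hxB with h | ⟨y, hy, hyx⟩ | ⟨y, hy, hyx⟩
    · exact absurd (hPK h) (he.notMem x hx')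
    · rcases eq_or_lt_of_le hy.1 with rfl | hy0
      · exact absurd (hyx ▸ he.zero_mem) (he.notMem x hx')
      · have := he.inj ⟨hy0, by linarith [hy.2]⟩ hx' hyx
        have : x = s := le_antisymm (this ▸ hy.2) hx.1
        simp [this]
    · rcases eq_or_lt_of_le hy.2 with rfl | hy1
      · exact absurd (hyx ▸ he.one_mem) (he.notMem x hx')
      · have := he.inj ⟨by linarith [hy.1], hy1⟩ hx' hyx
        have : x = t := le_antisymm hx.2 (this ▸ hy.1)
        simp [this]
  have hab : γ s ≠ γ t := fun h =>
    hst.ne (he.inj ⟨hs0, by linarith⟩ ⟨by linarith, ht1⟩ h)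
  have hseg : ∀ x y : ℝ, x ≤ y → Set.Icc x y ⊆ Set.Icc 0 1 →
      JoinedIn (γ '' Set.Icc x y) (γ x) (γ y) := fun x y hxy hsub =>
    (((convex_Icc x y).isPathConnected ⟨x, by simp [hxy]⟩).image' (he.cont.mono hsub)).joinedIn
      _ ⟨x, by simp [hxy], rfl⟩ _ ⟨y, by simp [hxy], rfl⟩
  have hjA : JoinedIn A (γ s) (γ t) := hseg s t hst.le hsub1
  have hjB : JoinedIn B (γ s) (γ t) := by
    refine JoinedIn.trans (((hseg 0 s hs0.le hsub2).mono ?_).symm.trans (hj.mono ?_))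
      ((hseg t 1 ht1.le hsub3).mono ?_).symm
    · exact fun z hz => Or.inr (Or.inl hz)
    · exact fun z hz => Or.inl hz
    · exact fun z hz => Or.inr (Or.inr hz)
  obtain ⟨lA, hlA, hlAf⟩ := hasLogOn_of_joinedIn (K := Aᶜ) (by rwa [compl_compl])
  obtain ⟨lB, hlB, hlBf⟩ := hasLogOn_of_joinedIn (K := Bᶜ) (by rwa [compl_compl])
  have hWK : ∀ z ∈ W, z ∉ K := fun z hz => hrK hz
  have hconst : ∀ p ∈ W \ (A ∪ B), ∀ q ∈ W \ (A ∪ B), lA p - lB p = lA q - lB q := by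
    intro p hp q hq
    rw [hABu] at hp hq
    have hpq := hcon p q (fun h => h.elim (hWK p hp.1) fun h => hp.2 (Or.inr h))
      (fun h => h.elim (hWK q hq.1) fun h => hq.2 (Or.inr h))
      ((((convex_ball _ _).isPathConnected ⟨_, hp.1⟩).joinedIn p hp.1 q hq.1).mono
        fun z hz => hWK z hz)
    rw [← hABu] at hpq
    have h1 : (A ∪ B)ᶜ ⊆ Aᶜ := Set.compl_subset_compl.2 Set.subset_union_left
    have h2 : (A ∪ B)ᶜ ⊆ Bᶜ := Set.compl_subset_compl.2 Set.subset_union_right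
    exact log_sub_log_eq_of_joinedIn (hlA.mono h1) (hlB.mono h2)
      (fun x hx => by rw [hlAf x (h1 hx), hlBf x (h2 hx)]) hpq
  obtain ⟨c, hc1, hc⟩ : ∃ c : ℂ, Complex.exp c = 1 ∧ ∀ z ∈ W \ (A ∪ B), lA z = lB z + c := by
    by_cases hne : (W \ (A ∪ B)).Nonempty
    · obtain ⟨p, hp⟩ := hne
      have hpA : p ∈ Aᶜ := fun h => hp.2 (Or.inl h)
      have hpB : p ∈ Bᶜ := fun h => hp.2 (Or.inr h)
      refine ⟨lA p - lB p, ?_, fun z hz => by rw [hconst p hp z hz]; ring⟩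
      rw [Complex.exp_sub, hlAf p hpA, ← hlBf p hpB, div_self (Complex.exp_ne_zero _)]
    · exact ⟨0, by simp, fun z hz => (hne ⟨z, hz⟩).elim⟩
  refine not_hasLogOn_compl_pair hab ⟨fun z => if z ∈ A then lB z + c else lA z, ?_, ?_⟩
  · intro z hz
    refine ContinuousAt.continuousWithinAt ?_
    by_cases hzA : z ∈ A
    · have hzB : z ∈ W ∩ Bᶜ := ⟨hAW hzA, fun h => hz (hABi ⟨hzA, h⟩)⟩
      have hn : W ∩ Bᶜ ∈ nhds z :=
        (Metric.isOpen_ball.inter hBc.isOpen_compl).mem_nhds hzB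
      have hct : ContinuousAt (fun z => lB z + c) z :=
        (hlB.continuousAt (hBc.isOpen_compl.mem_nhds hzB.2)).add continuousAt_const
      refine hct.congr (Filter.mem_of_superset hn fun w hw => ?_)
      by_cases hwA : w ∈ A
      · simp [hwA]
      · simp [hwA, hc w ⟨hw.1, fun h => h.elim hwA hw.2⟩]
    · have hn : Aᶜ ∈ nhds z := hAc.isOpen_compl.mem_nhds hzA
      refine (hlA.continuousAt hn).congr (Filter.mem_of_superset hn fun w hw => ?_)
      have : w ∉ A := hw
      simp [this]
  · intro z hz
    by_cases hzA : z ∈ A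
    · simp only [hzA, if_true]
      rw [Complex.exp_add, hc1, mul_one, hlBf z fun h => hz (hABi ⟨hzA, h⟩)]
    · simp only [hzA, if_false]
      exact hlAf z hzA

/-- If an ear separates two points, so does every closed curve through the ear. -/
theorem IsEar.not_joinedIn {K P : Set ℂ} {γ : ℝ → ℂ} (hK : IsCompact K) (he : IsEar K γ)
    (hPK : P ⊆ K) (hj : JoinedIn P (γ 0) (γ 1)) {p q : ℂ} (hp : p ∉ K ∪ trace γ)
    (hq : q ∉ K ∪ trace γ) (hpq : JoinedIn Kᶜ p q) (hsep : ¬ JoinedIn (K ∪ trace γ)ᶜ p q) :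
    ¬ JoinedIn (P ∪ trace γ)ᶜ p q := by
  intro h
  obtain ⟨g, hg, hgf⟩ := hasLogOn_of_joinedIn hpq
  obtain ⟨g', hg', hgf'⟩ := hasLogOn_of_joinedIn h
  have hP1 : P ⊆ P ∪ trace γ := Set.subset_union_left
  have hc := log_sub_log_eq_of_joinedIn (hg.mono hPK) (hg'.mono hP1)
    (fun x hx => by rw [hgf x (hPK hx), hgf' x (hP1 hx)]) hj
  have hγ0 : γ 0 ∈ P ∪ trace γ := Or.inl hj.source_mem
  have e0 : Complex.exp (g (γ 0) - g' (γ 0)) = 1 := by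
    rw [Complex.exp_sub, hgf _ he.zero_mem, ← hgf' _ hγ0, div_self (Complex.exp_ne_zero _)]
  have key : EarLog (fun z => (z - p) / (z - q)) K γ 0 := by
    refine ⟨g, fun t => g' (γ t) + (g (γ 0) - g' (γ 0)), hg, hgf, ?_, fun t ht => ?_, by ring, ?_⟩
    · exact (hg'.comp he.cont fun t ht => Or.inr ⟨t, ht, rfl⟩).add continuousOn_const
    · rw [Complex.exp_add, e0, mul_one, hgf' _ (Or.inr ⟨t, ht, rfl⟩)]
    · simp only [hc]
      push_cast
      ring
  exact hsep (joinedIn_of_hasLogOn (hK.union (isCompact_trace he.cont)) hp hq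
    (key.hasLogOn hK.isClosed he))

/-- `K` is compact and path connected, and its complement has at most `n + 1` path components. -/
structure HasFaces (K : Set ℂ) (n : ℕ) : Prop where
  isCompact : IsCompact K
  isPathConnected : IsPathConnected K
  exists_label : ∃ f : ℂ → Fin (n + 1), ∀ p ∉ K, ∀ q ∉ K, f p = f q ↔ JoinedIn Kᶜ p q

theorem isPathConnected_trace {γ : ℝ → ℂ} (hγ : ContinuousOn γ (Set.Icc 0 1)) :
    IsPathConnected (trace γ) :=
  ((convex_Icc (0 : ℝ) 1).isPathConnected ⟨0, by simp⟩).image' hγ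

theorem isPathConnected_union_trace {K : Set ℂ} {γ : ℝ → ℂ} (hK : IsPathConnected K)
    (hγ : ContinuousOn γ (Set.Icc 0 1)) (h0 : γ 0 ∈ K) : IsPathConnected (K ∪ trace γ) :=
  hK.union (isPathConnected_trace hγ) ⟨γ 0, h0, 0, by simp, rfl⟩

theorem hasFaces_singleton (p : ℂ) : HasFaces {p} 0 where
  isCompact := isCompact_singleton
  isPathConnected := isPathConnected_singleton p
  exists_label := by
    refine ⟨fun _ => 0, fun a ha b hb => ⟨fun _ => ?_, fun _ => rfl⟩⟩
    exact (isPathConnected_compl_singleton_of_one_lt_rank (by simp) p).joinedIn a ha b hb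

theorem HasFaces.leaf {K : Set ℂ} {n : ℕ} {γ : ℝ → ℂ} (h : HasFaces K n) (hγ : IsLeafArc K γ) :
    HasFaces (K ∪ trace γ) n where
  isCompact := h.isCompact.union (isCompact_trace hγ.cont)
  isPathConnected := isPathConnected_union_trace h.isPathConnected hγ.cont hγ.zero_mem
  exists_label := by
    obtain ⟨f, hf⟩ := h.exists_label
    refine ⟨f, fun p hp q hq => ?_⟩
    rw [hf p (fun h => hp (Or.inl h)) q (fun h => hq (Or.inl h))]
    exact ⟨hγ.joinedIn h.isCompact hp hq, fun h => h.mono (by simp)⟩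

/-- A path that is destroyed by attaching an ear meets the interior of the ear. -/
theorem IsEar.joinedIn_half {K : Set ℂ} {γ : ℝ → ℂ} (he : IsEar K γ) {p q : ℂ}
    (hpq : JoinedIn Kᶜ p q) (hn : ¬ JoinedIn (K ∪ trace γ)ᶜ p q) : JoinedIn Kᶜ p (γ (1 / 2)) := by
  obtain ⟨c, hc⟩ := id hpq
  obtain ⟨s, hs⟩ : ∃ s, c s ∈ trace γ := by
    by_contra! hcon
    exact hn ⟨c, fun s hs => hs.elim (hc s) (hcon s)⟩
  obtain ⟨t, ht, hts⟩ := hs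
  have htI : t ∈ Set.Ioo (0 : ℝ) 1 := by
    refine ⟨lt_of_le_of_ne ht.1 ?_, lt_of_le_of_ne ht.2 ?_⟩
    · rintro rfl
      exact hc s (hts ▸ he.zero_mem)
    · rintro rfl
      exact hc s (hts ▸ he.one_mem)
  have hps : JoinedIn Kᶜ p (c s) := by
    have : PathConnectedSpace unitInterval := isPathConnected_iff_pathConnectedSpace.1
      ((convex_Icc (0 : ℝ) 1).isPathConnected ⟨0, by simp⟩)
    have hc' : IsPathConnected (Set.range c) := isPathConnected_range c.continuous
    exact (hc'.joinedIn p ⟨0, c.source⟩ (c s) ⟨s, rfl⟩).mono (by rintro _ ⟨u, rfl⟩; exact hc u)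
  refine hps.trans ?_
  rw [← hts]
  have : IsPathConnected (γ '' Set.Ioo 0 1) :=
    ((convex_Ioo (0 : ℝ) 1).isPathConnected ⟨t, htI⟩).image' (he.cont.mono Set.Ioo_subset_Icc_self)
  refine (this.joinedIn _ ⟨t, htI, rfl⟩ _ ⟨1 / 2, by norm_num, rfl⟩).mono ?_
  rintro _ ⟨u, hu, rfl⟩
  exact he.notMem u hu

theorem HasFaces.ear {K : Set ℂ} {n : ℕ} {γ : ℝ → ℂ} (h : HasFaces K n) (hγ : IsEar K γ) :
    HasFaces (K ∪ trace γ) (n + 1) where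
  isCompact := h.isCompact.union (isCompact_trace hγ.cont)
  isPathConnected := isPathConnected_union_trace h.isPathConnected hγ.cont hγ.zero_mem
  exists_label := by
    obtain ⟨f, hf⟩ := h.exists_label
    have hmono {p q : ℂ} (h : JoinedIn (K ∪ trace γ)ᶜ p q) : JoinedIn Kᶜ p q := h.mono (by simp)
    by_cases hsep : ∃ p q, JoinedIn Kᶜ p q ∧ p ∉ K ∪ trace γ ∧ q ∉ K ∪ trace γ ∧
      ¬ JoinedIn (K ∪ trace γ)ᶜ p q
    swap
    · push Not at hsep
      refine ⟨fun z => (f z).castSucc, fun p hp q hq => ?_⟩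
      rw [Fin.castSucc_inj, hf p (fun h => hp (Or.inl h)) q (fun h => hq (Or.inl h))]
      exact ⟨fun h => hsep p q h hp hq, hmono⟩
    obtain ⟨p₀, q₀, hpq₀, hp₀, hq₀, hn₀⟩ := hsep
    have hhalf := hγ.joinedIn_half hpq₀ hn₀
    refine ⟨fun z => if JoinedIn (K ∪ trace γ)ᶜ q₀ z then Fin.last _ else (f z).castSucc,
      fun p hp q hq => ?_⟩
    have hpK : p ∉ K := fun h => hp (Or.inl h)
    have hqK : q ∉ K := fun h => hq (Or.inl h)
    by_cases h1 : JoinedIn (K ∪ trace γ)ᶜ q₀ p <;> by_cases h2 : JoinedIn (K ∪ trace γ)ᶜ q₀ q <;>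
      simp only [h1, h2, if_true, if_false]
    · exact iff_of_true trivial (h1.symm.trans h2)
    · exact iff_of_false (Fin.castSucc_lt_last _).ne' fun h => h2 (h1.trans h)
    · exact iff_of_false (Fin.castSucc_lt_last _).ne fun h => h1 (h2.trans h.symm)
    · rw [Fin.castSucc_inj, hf p hpK q hqK]
      refine ⟨fun hpq => ?_, hmono⟩
      by_contra hn
      have hp' : JoinedIn Kᶜ q₀ p :=
        (hpq₀.symm.trans hhalf).trans (hγ.joinedIn_half hpq hn).symm
      rcases hγ.joinedIn_or h.isCompact hq₀ hp hq hp' (hp'.trans hpq) with h | h | h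
      exacts [h1 h, h2 h, hn h]

/-- A planar drawing of the multigraph `ends` with vertices `pos v` and edges `arc e`. -/
structure IsDrawing {V ε : Type} (ends : ε → Sym2 V) (pos : V → ℂ) (arc : ε → ℝ → ℂ) : Prop where
  pos_inj : Function.Injective pos
  cont : ∀ e, ContinuousOn (arc e) (Set.Icc 0 1)
  endpoints : ∀ e a b, ends e = s(a, b) →
    (arc e 0 = pos a ∧ arc e 1 = pos b) ∨ (arc e 0 = pos b ∧ arc e 1 = pos a)
  inj : ∀ e, Set.InjOn (arc e) (Set.Ioo 0 1)
  arc_ne_arc : ∀ e f, e ≠ f → ∀ s ∈ Set.Ioo (0 : ℝ) 1, ∀ t ∈ Set.Icc (0 : ℝ) 1, arc e s ≠ arc f t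
  arc_ne_pos : ∀ e, ∀ s ∈ Set.Ioo (0 : ℝ) 1, ∀ w, arc e s ≠ pos w

theorem IsPlanar.exists_isDrawing {V ε : Type} {ends : ε → Sym2 V} (h : IsPlanar ends) :
    ∃ pos arc, IsDrawing ends pos arc := by
  obtain ⟨pos, arc, h1, h2, h3, h4, h5, h6⟩ := h
  let φ := Complex.equivRealProdCLM.symm
  refine ⟨fun v => φ (pos v), fun e t => φ (arc e t), φ.injective.comp h1,
    fun e => φ.continuous.comp_continuousOn (h2 e), fun e a b he => ?_,
    fun e => φ.injective.comp_injOn ((h4 e).mono Set.Ioo_subset_Ico_self),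
    fun e f hef s hs t ht h => h5 e f hef s hs t ht (φ.injective h),
    fun e s hs w h => h6 e s hs w (φ.injective h)⟩
  rcases h3 e a b he with ⟨h, h'⟩ | ⟨h, h'⟩
  · exact Or.inl ⟨congrArg φ h, congrArg φ h'⟩
  · exact Or.inr ⟨congrArg φ h, congrArg φ h'⟩

/-- The part of a drawing formed by the vertices in `W` and the edges in `F`. -/
def draw {V ε : Type} (pos : V → ℂ) (arc : ε → ℝ → ℂ) (W : Set V) (F : Set ε) : Set ℂ :=
  pos '' W ∪ ⋃ e ∈ F, trace (arc e)

section Drawing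

variable {V ε : Type} {ends : ε → Sym2 V} {pos : V → ℂ} {arc : ε → ℝ → ℂ}

theorem draw_mono {W W' : Set V} {F F' : Set ε} (hW : W ⊆ W') (hF : F ⊆ F') :
    draw pos arc W F ⊆ draw pos arc W' F' :=
  Set.union_subset_union (Set.image_mono hW) (Set.biUnion_subset_biUnion_left hF)

theorem pos_mem_draw {W : Set V} {F : Set ε} {a : V} (ha : a ∈ W) : pos a ∈ draw pos arc W F :=
  Or.inl ⟨a, ha, rfl⟩

theorem draw_insert_edge (W : Set V) (F : Set ε) (e : ε) :
    draw pos arc W (insert e F) = draw pos arc W F ∪ trace (arc e) := by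
  simp only [draw, Set.biUnion_insert]
  rw [Set.union_assoc, Set.union_comm (trace _)]

theorem IsDrawing.trace_eq (h : IsDrawing ends pos arc) {e : ε} {a b : V} (he : ends e = s(a, b)) :
    trace (arc e) = arc e '' Set.Ioo 0 1 ∪ {pos a, pos b} := by
  have : Set.Icc (0 : ℝ) 1 = Set.Ioo 0 1 ∪ {0, 1} := by
    rw [Set.Ioo_union_both zero_le_one]
  rw [trace, this, Set.image_union, Set.image_pair]
  rcases h.endpoints e a b he with ⟨h0, h1⟩ | ⟨h0, h1⟩
  · rw [h0, h1]
  · rw [h0, h1, Set.pair_comm]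

theorem IsDrawing.pos_mem_trace (h : IsDrawing ends pos arc) {e : ε} {a : V} (he : a ∈ ends e) :
    pos a ∈ trace (arc e) := by
  obtain ⟨b, hb⟩ := he
  rw [h.trace_eq hb]
  simp

theorem IsDrawing.arc_notMem_draw (h : IsDrawing ends pos arc) {W : Set V} {F : Set ε} {e : ε}
    (he : e ∉ F) {t : ℝ} (ht : t ∈ Set.Ioo (0 : ℝ) 1) : arc e t ∉ draw pos arc W F := by
  rintro (⟨w, -, hw⟩ | hm)
  · exact h.arc_ne_pos e t ht w hw.symm
  · simp only [Set.mem_iUnion] at hm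
    obtain ⟨f, hf, s, hs, hst⟩ := hm
    exact h.arc_ne_arc e f (fun h => he (h ▸ hf)) t ht s hs hst.symm

theorem IsDrawing.pos_notMem_draw (h : IsDrawing ends pos arc) {W : Set V} {F : Set ε}
    (hF : ∀ e ∈ F, ∀ w ∈ ends e, w ∈ W) {b : V} (hb : b ∉ W) : pos b ∉ draw pos arc W F := by
  rintro (⟨w, hw, hwb⟩ | hm)
  · exact hb (h.pos_inj hwb ▸ hw)
  · simp only [Set.mem_iUnion] at hm
    obtain ⟨f, hf, hfb⟩ := hm
    obtain ⟨x, y, hxy⟩ : ∃ x y, ends f = s(x, y) := by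
      induction h : ends f with | _ x y => exact ⟨x, y, rfl⟩
    rw [h.trace_eq hxy] at hfb
    rcases hfb with ⟨t, ht, htb⟩ | hfb | hfb
    · exact h.arc_ne_pos f t ht b htb
    · exact hb (h.pos_inj hfb ▸ hF f hf x (by simp [hxy]))
    · exact hb (h.pos_inj hfb ▸ hF f hf y (by simp [hxy]))

theorem IsDrawing.isEar (h : IsDrawing ends pos arc) {W : Set V} {F : Set ε} {e : ε}
    (hW : ∀ w ∈ ends e, w ∈ W) (he : e ∉ F) : IsEar (draw pos arc W F) (arc e) := by
  obtain ⟨x, y, hxy⟩ : ∃ x y, ends e = s(x, y) := by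
    induction h : ends e with | _ x y => exact ⟨x, y, rfl⟩
  have hx : pos x ∈ draw pos arc W F := pos_mem_draw (hW x (by simp [hxy]))
  have hy : pos y ∈ draw pos arc W F := pos_mem_draw (hW y (by simp [hxy]))
  refine ⟨h.cont e, h.inj e, ?_, ?_, fun t ht => h.arc_notMem_draw he ht⟩
  · rcases h.endpoints e x y hxy with h | h <;> rw [h.1] <;> assumption
  · rcases h.endpoints e x y hxy with h | h <;> rw [h.2] <;> assumption

/-- An edge can be traversed in both directions. -/
theorem IsDrawing.exists_arc (h : IsDrawing ends pos arc) {e : ε} {a b : V}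
    (he : ends e = s(a, b)) : ∃ γ : ℝ → ℂ, ContinuousOn γ (Set.Icc 0 1) ∧ γ 0 = pos a ∧
      γ 1 = pos b ∧ Set.InjOn γ (Set.Ioo 0 1) ∧ trace γ = trace (arc e) ∧
      ∀ t ∈ Set.Ioo (0 : ℝ) 1, ∃ s ∈ Set.Ioo (0 : ℝ) 1, γ t = arc e s := by
  rcases h.endpoints e a b he with ⟨h0, h1⟩ | ⟨h0, h1⟩
  · exact ⟨arc e, h.cont e, h0, h1, h.inj e, rfl, fun t ht => ⟨t, ht, rfl⟩⟩
  · have hmaps : ∀ t ∈ Set.Ioo (0 : ℝ) 1, 1 - t ∈ Set.Ioo (0 : ℝ) 1 := fun t ht =>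
      ⟨by linarith [ht.2], by linarith [ht.1]⟩
    refine ⟨fun t => arc e (1 - t), (h.cont e).comp (by fun_prop) fun t ht =>
      ⟨by linarith [ht.2], by linarith [ht.1]⟩, by simpa using h1, by simpa using h0,
      fun s hs t ht hst => ?_, ?_, fun t ht => ⟨1 - t, hmaps t ht, rfl⟩⟩
    · linarith [h.inj e (hmaps s hs) (hmaps t ht) hst]
    · rw [trace, trace, ← Set.image_image (arc e) (fun t => 1 - t)]
      simp

theorem IsDrawing.hasFaces_leaf (h : IsDrawing ends pos arc) {W : Set V} {F : Set ε} {n : ℕ}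
    (hF : ∀ e ∈ F, ∀ w ∈ ends e, w ∈ W) (hK : HasFaces (draw pos arc W F) n) {e : ε} {a b : V}
    (he : ends e = s(a, b)) (ha : a ∈ W) (hb : b ∉ W) :
    HasFaces (draw pos arc (insert b W) (insert e F)) n := by
  obtain ⟨γ, hγ, h0, h1, hinj, htr, hIoo⟩ := h.exists_arc he
  have heF : e ∉ F := fun h => hb (hF e h b (by simp [he]))
  have hbK := h.pos_notMem_draw hF hb
  have hne : ∀ t ∈ Set.Ioo (0 : ℝ) 1, γ t ≠ γ 1 := fun t ht htb => by
    obtain ⟨s, hs, hst⟩ := hIoo t ht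
    exact h.arc_ne_pos e s hs b (by rw [← hst, htb, h1])
  have hleaf : IsLeafArc (draw pos arc W F) γ := by
    refine ⟨hγ, ?_, h0 ▸ pos_mem_draw ha, ?_⟩
    · rw [← Set.Ioo_insert_right one_pos, Set.injOn_insert (by simp)]
      exact ⟨hinj, fun ⟨t, ht, h⟩ => hne t ht h⟩
    · intro t ht
      rcases eq_or_lt_of_le ht.2 with rfl | hlt
      · rwa [h1]
      · obtain ⟨s, hs, hst⟩ := hIoo t ⟨ht.1, hlt⟩
        rw [hst]
        exact h.arc_notMem_draw heF hs
  convert hK.leaf hleaf using 1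
  rw [draw_insert_edge, htr]
  apply Set.Subset.antisymm
  · rintro z (hz | hz)
    · rcases hz with ⟨w, rfl | hw, rfl⟩ | hz
      · exact Or.inr (h.pos_mem_trace (by simp [he]))
      · exact Or.inl (pos_mem_draw hw)
      · exact Or.inl (Or.inr hz)
    · exact Or.inr hz
  · exact Set.union_subset_union_left _ (draw_mono (Set.subset_insert _ _) subset_rfl)

theorem IsDrawing.hasFaces_ear (h : IsDrawing ends pos arc) {W : Set V} {F : Set ε} {n : ℕ}
    (hK : HasFaces (draw pos arc W F) n) {e : ε}
    (hW : ∀ w ∈ ends e, w ∈ W) (he : e ∉ F) :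
    HasFaces (draw pos arc W (insert e F)) (n + 1) := by
  rw [draw_insert_edge]
  exact hK.ear (h.isEar hW he)

theorem exists_edge_leaving (hconn : MGConnected ends) {W : Set V} (hne : W.Nonempty)
    (hW : W ≠ Set.univ) : ∃ e a b, ends e = s(a, b) ∧ a ∈ W ∧ b ∉ W := by
  obtain ⟨r, hr⟩ := hne
  obtain ⟨v, hv⟩ := (Set.ne_univ_iff_exists_notMem W).1 hW
  have := hconn.2 r trivial v trivial
  induction this with
  | refl => exact absurd hr hv
  | @tail x y _ hxy ih =>
    by_cases hx : x ∈ W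
    · obtain ⟨-, -, e, he⟩ := hxy
      exact ⟨e, x, y, he, hx, hv⟩
    · exact ih hx

theorem IsDrawing.exists_spanning_tree [Fintype V] (h : IsDrawing ends pos arc)
    (hconn : MGConnected ends) : ∃ F : Finset ε, Fintype.card V = F.card + 1 ∧
      HasFaces (draw pos arc Set.univ (F : Set ε)) 0 := by
  have key : ∀ k, k + 1 ≤ Fintype.card V → ∃ (W : Finset V) (F : Finset ε), W.card = k + 1 ∧
      F.card = k ∧ (∀ e ∈ F, ∀ w ∈ ends e, w ∈ W) ∧
      HasFaces (draw pos arc (W : Set V) (F : Set ε)) 0 := by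
    intro k
    induction k with
    | zero =>
      intro _
      obtain ⟨r, -⟩ := hconn.1
      refine ⟨{r}, ∅, by simp, by simp, by simp, ?_⟩
      simpa [draw] using hasFaces_singleton (pos r)
    | succ k ih =>
      intro hk
      obtain ⟨W, F, hW, hF, hWF, hK⟩ := ih (by omega)
      obtain ⟨e, a, b, he, ha, hb⟩ := exists_edge_leaving hconn (W := (W : Set V))
        (by simpa using Finset.card_pos.1 (by omega)) (fun h => by
          have : W = Finset.univ := by simpa using h
          rw [this, Finset.card_univ] at hW
          omega)
      have heF : e ∉ F := fun h => hb (hWF e h b (by simp [he]))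
      simp only [Finset.mem_coe] at ha hb
      refine ⟨insert b W, insert e F, by simp [hb, hW], by simp [heF, hF], ?_, ?_⟩
      · intro f hf w hw
        rcases Finset.mem_insert.1 hf with rfl | hf
        · rw [he, Sym2.mem_iff] at hw
          rcases hw with rfl | rfl <;> simp [ha]
        · exact Finset.mem_insert_of_mem (hWF f hf w hw)
      · push_cast
        exact h.hasFaces_leaf hWF hK he ha hb
  have hpos : 0 < Fintype.card V := Fintype.card_pos_iff.2 ⟨hconn.1.some⟩
  obtain ⟨W, F, hW, hF, -, hK⟩ := key (Fintype.card V - 1) (by omega)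
  have : W = Finset.univ := by rw [← Finset.card_eq_iff_eq_univ]; omega
  subst this
  exact ⟨F, by omega, by simpa using hK⟩

/-- One half of Euler's formula. -/
theorem IsDrawing.exists_hasFaces [Fintype V] [Fintype ε] (h : IsDrawing ends pos arc)
    (hconn : MGConnected ends) : ∃ n, n + Fintype.card V = Fintype.card ε + 1 ∧
      HasFaces (draw pos arc Set.univ Set.univ) n := by
  obtain ⟨F, hF, hK⟩ := h.exists_spanning_tree hconn
  have key : ∀ F' : Finset ε, Disjoint F F' →
      HasFaces (draw pos arc Set.univ ((F ∪ F' : Finset ε) : Set ε)) F'.card := by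
    intro F'
    induction F' using Finset.induction_on with
    | empty => simpa using hK
    | insert e F' he ih =>
      intro hd
      rw [Finset.disjoint_insert_right] at hd
      rw [Finset.card_insert_of_notMem he, Finset.union_insert, Finset.coe_insert]
      exact h.hasFaces_ear (ih hd.2) (fun _ _ => trivial) (by simp [he, hd.1])
  refine ⟨Fᶜ.card, ?_, by simpa using key Fᶜ disjoint_compl_right⟩
  have := Finset.card_add_card_compl F
  omega

end Drawing

section Dual

variable {V ε : Type} {ends : ε → Sym2 V} {pos : V → ℂ} {arc : ε → ℝ → ℂ}

open Fin.NatCast Fin.CommRing in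
/-- A cycle can be traversed starting just after any of its edges. -/
theorem IsCycle.exists_rotation {C : Finset ε} (hC : IsCycle ends C) {d : ε} (hd : d ∈ C) :
    ∃ (n : ℕ) (v : ℕ → V) (e : ℕ → ε), Set.InjOn v (Set.Iic n) ∧ Set.InjOn e (Set.Iic n) ∧
      (∀ i, ends (e i) = s(v i, v (i + 1))) ∧ v (n + 1) = v 0 ∧ e n = d ∧
      (C : Set ε) = e '' Set.Iic n := by
  obtain ⟨n, v, e, hv, he, hend, rfl⟩ := hC
  obtain ⟨j, -, rfl⟩ := Finset.mem_image.1 hd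
  have hcast : Set.InjOn (fun i : ℕ => j + 1 + (i : Fin (n + 1))) (Set.Iic n) := by
    intro a ha b hb hab
    have := add_left_cancel hab
    rw [Fin.ext_iff, Fin.val_natCast, Fin.val_natCast, Nat.mod_eq_of_lt (Nat.lt_succ_of_le ha),
      Nat.mod_eq_of_lt (Nat.lt_succ_of_le hb)] at this
    exact this
  refine ⟨n, fun i => v (j + 1 + i), fun i => e (j + 1 + i), fun a ha b hb hab =>
    hcast ha hb (hv hab), fun a ha b hb hab => hcast ha hb (he hab), fun i => ?_, ?_, ?_, ?_⟩
  · rw [hend]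
    push_cast
    rw [add_assoc (j + 1)]
  · simp
  · have : j + 1 + ((n : ℕ) : Fin (n + 1)) = j := by
      have h0 : ((n + 1 : ℕ) : Fin (n + 1)) = 0 := by simp
      push_cast at h0
      rw [add_assoc, add_comm 1, h0, add_zero]
    exact congrArg e this
  · ext x
    simp only [Finset.coe_image, Finset.coe_univ, Set.image_univ, Set.mem_range, Set.mem_image,
      Set.mem_Iic]
    constructor
    · rintro ⟨i, rfl⟩
      refine ⟨((i - (j + 1) : Fin (n + 1)) : ℕ), Nat.le_of_lt_succ (i - (j + 1)).2, ?_⟩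
      rw [Fin.cast_val_eq_self]
      congr 1
      abel
    · rintro ⟨i, -, rfl⟩
      exact ⟨_, rfl⟩

theorem IsDrawing.hasFaces_path (h : IsDrawing ends pos arc) {n : ℕ} {v : ℕ → V} {e : ℕ → ε}
    (hv : Set.InjOn v (Set.Iic n)) (he : ∀ i, ends (e i) = s(v i, v (i + 1))) :
    HasFaces (draw pos arc (v '' Set.Iic n) (e '' Set.Iio n)) 0 := by
  induction n with
  | zero =>
    have : Set.Iic 0 = {0} := by ext; simp
    simpa [draw, this] using hasFaces_singleton (pos (v 0))
  | succ n ih =>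
    have hins : Set.Iic (n + 1) = insert (n + 1) (Set.Iic n) := by ext; simp; omega
    have hins' : Set.Iio (n + 1) = insert n (Set.Iio n) := by
      ext
      simp [Order.lt_add_one_iff, le_iff_eq_or_lt]
    rw [hins, hins', Set.image_insert_eq, Set.image_insert_eq]
    refine h.hasFaces_leaf ?_ (ih (hv.mono fun i hi => Nat.le_succ_of_le hi)) (he n)
      ⟨n, by simp, rfl⟩ ?_
    · rintro _ ⟨i, hi, rfl⟩ w hw
      rw [he, Sym2.mem_iff] at hw
      rw [Set.mem_Iio] at hi
      rcases hw with rfl | rfl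
      · exact ⟨i, hi.le, rfl⟩
      · exact ⟨i + 1, hi, rfl⟩
    · rintro ⟨i, hi, hin⟩
      rw [Set.mem_Iic] at hi
      have := hv (Nat.le_succ_of_le hi) (Set.mem_Iic.2 le_rfl) hin
      omega

/-- Removing an edge from a cycle leaves a path whose complement is connected. -/
theorem IsDrawing.exists_path_of_cycle (h : IsDrawing ends pos arc) {C : Finset ε}
    (hC : IsCycle ends C) {d : ε} (hd : d ∈ C) : ∃ (W : Set V) (P : Set ε), d ∉ P ∧
      HasFaces (draw pos arc W P) 0 ∧ (∀ w ∈ ends d, w ∈ W) ∧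
      draw pos arc W P ∪ trace (arc d) = draw pos arc ∅ C := by
  obtain ⟨n, v, e, hv, he, hend, hlast, rfl, hCe⟩ := hC.exists_rotation hd
  refine ⟨_, _, ?_, h.hasFaces_path hv hend, ?_, ?_⟩
  · rintro ⟨i, hi, hin⟩
    rw [Set.mem_Iio] at hi
    exact hi.ne (he hi.le (Set.mem_Iic.2 le_rfl) hin)
  · intro w hw
    rw [hend, hlast, Sym2.mem_iff] at hw
    rcases hw with rfl | rfl
    · exact ⟨n, by simp, rfl⟩
    · exact ⟨0, by simp, rfl⟩
  · rw [← draw_insert_edge, ← Set.image_insert_eq, Set.Iio_insert, hCe]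
    refine Set.Subset.antisymm ?_ (draw_mono (Set.empty_subset _) subset_rfl)
    refine Set.union_subset ?_ Set.subset_union_right
    rintro _ ⟨_, ⟨i, hi, rfl⟩, rfl⟩
    exact Or.inr (Set.mem_biUnion (Set.mem_image_of_mem e hi)
      (h.pos_mem_trace (by simp [hend])))

theorem IsDrawing.isCompact_draw [Finite V] [Finite ε] (h : IsDrawing ends pos arc) (W : Set V)
    (F : Set ε) : IsCompact (draw pos arc W F) :=
  ((Set.toFinite W).image pos).isCompact.union
    ((Set.toFinite F).isCompact_biUnion fun e _ => isCompact_trace (h.cont e))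

theorem IsDrawing.hasFaces_cycle (h : IsDrawing ends pos arc) {C : Finset ε}
    (hC : IsCycle ends C) : HasFaces (draw pos arc ∅ C) 1 := by
  obtain ⟨d, hd⟩ : C.Nonempty := by
    obtain ⟨n, v, e, -, -, -, rfl⟩ := hC
    simp
  obtain ⟨W, P, hdP, hP, hW, hPC⟩ := h.exists_path_of_cycle hC hd
  rw [← hPC, ← draw_insert_edge]
  exact h.hasFaces_ear hP hW hdP

/-- The two sides of an edge are separated by exactly the cycles through that edge. -/
theorem IsDrawing.exists_sides [Finite V] [Finite ε] (h : IsDrawing ends pos arc) (d : ε) :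
    ∃ p q, p ∉ draw pos arc Set.univ Set.univ ∧ q ∉ draw pos arc Set.univ Set.univ ∧
      ∀ C, IsCycle ends C → (d ∈ C ↔ ¬ JoinedIn (draw pos arc ∅ C)ᶜ p q) := by
  by_cases hex : ∃ C, IsCycle ends C ∧ d ∈ C
  swap
  · push Not at hex
    obtain ⟨r, hr⟩ := (h.isCompact_draw Set.univ Set.univ).isBounded.subset_ball 0
    have hz : ((r : ℝ) : ℂ) ∉ draw pos arc Set.univ Set.univ := fun hz => by
      have := hr hz
      rw [mem_ball_zero_iff, Complex.norm_real] at this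
      exact absurd (le_abs_self r) (not_le.2 this)
    refine ⟨r, r, hz, hz, fun C hC => iff_of_false (hex C hC) (not_not.2 (JoinedIn.refl ?_))⟩
    exact fun hz' => hz (draw_mono (Set.empty_subset _) (Set.subset_univ _) hz')
  obtain ⟨C₀, hC₀, hd₀⟩ := hex
  set K := draw pos arc Set.univ {d}ᶜ with hK
  have hKc : IsCompact K := h.isCompact_draw _ _
  have hear : IsEar K (arc d) := h.isEar (fun _ _ => trivial) (by simp)
  have hKd : K ∪ trace (arc d) = draw pos arc Set.univ Set.univ := by
    rw [hK, ← draw_insert_edge]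
    congr 1
    ext x
    simp [em]
  have hsub {W : Set V} {P : Set ε} (hdP : d ∉ P) : draw pos arc W P ⊆ K :=
    draw_mono (Set.subset_univ _) (Set.subset_compl_singleton_iff.2 hdP)
  have hjoin {W : Set V} {P : Set ε} (hP : HasFaces (draw pos arc W P) 0)
      (hW : ∀ w ∈ ends d, w ∈ W) (hdP : d ∉ P) :
      JoinedIn (draw pos arc W P) (arc d 0) (arc d 1) :=
    hP.isPathConnected.joinedIn _ (h.isEar hW hdP).zero_mem _ (h.isEar hW hdP).one_mem
  obtain ⟨W, P, hdP, hP, hW, -⟩ := h.exists_path_of_cycle hC₀ hd₀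
  obtain ⟨p, q, hp, hq, hpq, hn⟩ := hear.exists_separated hKc.isClosed (hsub hdP)
    hP.isCompact.isClosed (hjoin hP hW hdP)
  have hn' : ¬ JoinedIn (K ∪ trace (arc d))ᶜ p q := fun hj =>
    hn (hj.mono (Set.compl_subset_compl.2 (Set.union_subset_union_left _ (hsub hdP))))
  refine ⟨p, q, hKd ▸ hp, hKd ▸ hq, fun C hC => ⟨fun hdC => ?_, fun hnj => ?_⟩⟩
  · obtain ⟨W', P', hdP', hP', hW', hPC⟩ := h.exists_path_of_cycle hC hdC
    rw [← hPC]
    exact hear.not_joinedIn hKc (hsub hdP') (hjoin hP' hW' hdP') hp hq hpq hn'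
  · by_contra hdC
    exact hnj (hpq.mono (Set.compl_subset_compl.2 (hsub (by simpa using hdC))))

/-- A connected planar multigraph has a dual `(a, b)` with the number of vertices prescribed by
Euler's formula, in which cycles become cuts. -/
theorem IsPlanar.exists_dual [Fintype V] [Fintype ε] (h : IsPlanar ends)
    (hconn : MGConnected ends) : ∃ (n : ℕ) (a b : ε → Fin (n + 1)),
      n + Fintype.card V = Fintype.card ε + 1 ∧
      ∀ C, IsCycle ends C → ∃ S : Set (Fin (n + 1)), ∀ e, e ∈ C ↔ ¬ (a e ∈ S ↔ b e ∈ S) := by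
  obtain ⟨pos, arc, hd⟩ := h.exists_isDrawing
  obtain ⟨n, hn, hK⟩ := hd.exists_hasFaces hconn
  obtain ⟨f, hf⟩ := hK.exists_label
  choose p q hp hq hpq using hd.exists_sides
  refine ⟨n, fun e => f (p e), fun e => f (q e), hn, fun C hC => ?_⟩
  obtain ⟨g, hg⟩ := (hd.hasFaces_cycle hC).exists_label
  have hsub : draw pos arc ∅ (C : Set ε) ⊆ draw pos arc Set.univ Set.univ :=
    draw_mono (Set.empty_subset _) (Set.subset_univ _)
  have hfg {x y : ℂ} (hx : x ∉ draw pos arc Set.univ Set.univ)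
      (hy : y ∉ draw pos arc Set.univ Set.univ) (hxy : f x = f y) : g x = g y :=
    (hg x (fun h => hx (hsub h)) y (fun h => hy (hsub h))).2
      (((hf x hx y hy).1 hxy).mono (Set.compl_subset_compl.2 hsub))
  refine ⟨{i | ∃ x ∉ draw pos arc Set.univ Set.univ, f x = i ∧ g x = 0}, fun e => ?_⟩
  have hmem {x : ℂ} (hx : x ∉ draw pos arc Set.univ Set.univ) :
      f x ∈ {i | ∃ x ∉ draw pos arc Set.univ Set.univ, f x = i ∧ g x = 0} ↔ g x = 0 :=
    ⟨fun ⟨y, hy, hyx, hy0⟩ => hfg hy hx hyx ▸ hy0, fun h0 => ⟨x, hx, rfl, h0⟩⟩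
  rw [hpq e C hC, hmem (hp e), hmem (hq e),
    ← hg _ (fun h => hp e (hsub h)) _ (fun h => hq e (hsub h))]
  generalize g (p e) = i
  generalize g (q e) = j
  revert i j
  decide

end Dual

section Duality

variable {V ε Φ : Type}

/-- The coboundary map of the multigraph whose edge `e` joins `x e` and `y e`. -/
def cob (x y : ε → V) : (V → ZMod 2) →ₗ[ZMod 2] (ε → ZMod 2) where
  toFun w e := w (x e) + w (y e)
  map_add' w w' := by
    ext e
    simp only [Pi.add_apply]
    ring
  map_smul' c w := by
    ext e
    simp only [Pi.smul_apply, smul_eq_mul, RingHom.id_apply]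
    ring

theorem cob_apply (x y : ε → V) (w : V → ZMod 2) (e : ε) : cob x y w e = w (x e) + w (y e) := rfl

theorem finrank_range_cob_lt [Fintype V] [Nonempty V] [Fintype ε] (x y : ε → V) :
    Module.finrank (ZMod 2) (LinearMap.range (cob x y)) + 1 ≤ Fintype.card V := by
  have h := LinearMap.finrank_range_add_finrank_ker (cob x y)
  rw [Module.finrank_fintype_fun_eq_card] at h
  rw [← h, Nat.add_le_add_iff_left, Nat.one_le_iff_ne_zero, Ne, Submodule.finrank_eq_zero]
  intro hbot
  have : (1 : V → ZMod 2) ∈ LinearMap.ker (cob x y) := by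
    ext e
    simp only [cob_apply, Pi.one_apply, Pi.zero_apply]
    exact CharTwo.add_self_eq_zero 1
  rw [hbot, Submodule.mem_bot] at this
  exact one_ne_zero this

/-- The dot product as a bilinear form over the field with two elements. -/
def dotForm (ε : Type) [Fintype ε] : LinearMap.BilinForm (ZMod 2) (ε → ZMod 2) :=
  dotProductBilin (ZMod 2) (ZMod 2)

theorem dotForm_apply [Fintype ε] (z w : ε → ZMod 2) : dotForm ε z w = z ⬝ᵥ w := rfl

theorem dotForm_isRefl [Fintype ε] : (dotForm ε).IsRefl := fun z w h => by
  rw [dotForm_apply] at *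
  rwa [dotProduct_comm]

theorem dotForm_nondegenerate [Fintype ε] : (dotForm ε).Nondegenerate :=
  ⟨fun z h => dotProduct_eq_zero z h, fun z h => dotProduct_eq_zero z fun w => by
    rw [dotProduct_comm]; exact h w⟩

/-- The binary cycle space of a multigraph. -/
def cycleSpace [Fintype ε] (x y : ε → V) : Submodule (ZMod 2) (ε → ZMod 2) :=
  (dotForm ε).orthogonal (LinearMap.range (cob x y))

theorem mem_cycleSpace [Fintype ε] {x y : ε → V} {z : ε → ZMod 2} :
    z ∈ cycleSpace x y ↔ ∀ w : V → ZMod 2, ∑ e, z e * (w (x e) + w (y e)) = 0 := by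
  simp only [cycleSpace, LinearMap.BilinForm.mem_orthogonal_iff, LinearMap.mem_range,
    forall_exists_index, forall_apply_eq_imp_iff]
  refine forall_congr' fun w => ?_
  change cob x y w ⬝ᵥ z = 0 ↔ _
  rw [dotProduct_comm]
  rfl

theorem le_finrank_cycleSpace [Fintype V] [Nonempty V] [Fintype ε] (x y : ε → V) :
    Fintype.card ε + 1 ≤ Module.finrank (ZMod 2) (cycleSpace x y) + Fintype.card V := by
  have h := LinearMap.BilinForm.finrank_orthogonal (dotForm_nondegenerate (ε := ε))
    (LinearMap.range (cob x y))
  have h' := finrank_range_cob_lt x y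
  have h'' := Submodule.finrank_le (LinearMap.range (cob x y))
  rw [Module.finrank_fintype_fun_eq_card] at h h''
  rw [cycleSpace, h]
  omega

/-- The characteristic vector of a set of edges. -/
def charVec (C : Set ε) (e : ε) : ZMod 2 := if e ∈ C then 1 else 0

theorem zmod_two_eq_one {z : ZMod 2} (h : z ≠ 0) : z = 1 := by
  revert z; decide

theorem exists_endpoints (ends : ε → Sym2 V) : ∃ x y : ε → V, ∀ e, ends e = s(x e, y e) := by
  have : ∀ e, ∃ a b, ends e = s(a, b) := fun e => by
    induction h : ends e with | _ a b => exact ⟨a, b, rfl⟩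
  choose x y h using this
  exact ⟨x, y, h⟩

theorem IsCycle.charVec_mem [Fintype ε] {ends : ε → Sym2 V} {x y : ε → V}
    (hxy : ∀ e, ends e = s(x e, y e)) {C : Finset ε} (hC : IsCycle ends C) :
    charVec (C : Set ε) ∈ cycleSpace x y := by
  rw [mem_cycleSpace]
  intro w
  obtain ⟨n, v, e, -, he, hend, rfl⟩ := hC
  simp only [charVec, Finset.mem_coe, ite_mul, one_mul, zero_mul]
  rw [← Finset.sum_filter, Finset.filter_mem_eq_inter, Finset.univ_inter,
    Finset.sum_image he.injOn]
  have h : ∀ i, w (x (e i)) + w (y (e i)) = w (v i) + w (v (i + 1)) := by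
    intro i
    have := (hxy (e i)).symm.trans (hend i)
    rcases Sym2.eq_iff.1 this with ⟨h, h'⟩ | ⟨h, h'⟩
    · rw [h, h']
    · rw [h, h', add_comm]
  simp only [h, Finset.sum_add_distrib]
  have := Equiv.sum_comp (Equiv.addRight (1 : Fin (n + 1))) (fun i => w (v i))
  simp only [Equiv.coe_addRight] at this
  rw [this]
  exact CharTwo.add_self_eq_zero _

/-- Every element of the cycle space contains a cycle through any of its edges. -/
theorem exists_cycle_of_mem_cycleSpace [Fintype ε] {ends : ε → Sym2 V} {x y : ε → V}
    (hxy : ∀ e, ends e = s(x e, y e)) {z : ε → ZMod 2} (hz : z ∈ cycleSpace x y) {d : ε}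
    (hd : z d ≠ 0) : ∃ C, IsCycle ends C ∧ d ∈ C ∧ ∀ e ∈ C, z e ≠ 0 := by
  let Γ : SimpleGraph V := SimpleGraph.fromRel fun u v => ∃ e, z e ≠ 0 ∧ e ≠ d ∧ ends e = s(u, v)
  have hΓ {u v : V} (h : Γ.Adj u v) : ∃ e, z e ≠ 0 ∧ e ≠ d ∧ ends e = s(u, v) := by
    rcases ((SimpleGraph.fromRel_adj _ _ _).1 h).2 with ⟨e, h1, h2, h3⟩ | ⟨e, h1, h2, h3⟩
    · exact ⟨e, h1, h2, h3⟩
    · exact ⟨e, h1, h2, h3.trans Sym2.eq_swap⟩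
  have hreach : Γ.Reachable (x d) (y d) := by
    by_contra hn
    rw [mem_cycleSpace] at hz
    have := hz fun v => if Γ.Reachable (x d) v then 1 else 0
    rw [Finset.sum_eq_single d] at this
    · simp [hn, hd] at this
    · intro e _ hed
      by_cases hze : z e = 0
      · simp [hze]
      have : Γ.Reachable (x d) (x e) ↔ Γ.Reachable (x d) (y e) := by
        by_cases hne : x e = y e
        · rw [hne]
        have : Γ.Adj (x e) (y e) :=
          (SimpleGraph.fromRel_adj _ _ _).2 ⟨hne, Or.inl ⟨e, hze, hed, hxy e⟩⟩
        exact ⟨fun h => h.trans this.reachable, fun h => h.trans this.symm.reachable⟩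
      simp only [this, CharTwo.add_self_eq_zero, mul_zero]
    · simp
  obtain ⟨p, hp⟩ := hreach.symm.exists_isPath
  have hinj := hp.getVert_injOn
  have hchoice : ∀ i, ∃ e, i < p.length →
      z e ≠ 0 ∧ e ≠ d ∧ ends e = s(p.getVert i, p.getVert (i + 1)) := fun i => by
    by_cases hi : i < p.length
    · obtain ⟨e, he⟩ := hΓ (p.adj_getVert_succ hi)
      exact ⟨e, fun _ => he⟩
    · exact ⟨d, fun h => absurd h hi⟩
  choose f hf using hchoice
  let g : Fin (p.length + 1) → ε := fun i => if (i : ℕ) < p.length then f i else d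
  have hg : ∀ i : Fin (p.length + 1), ends (g i) = s(p.getVert i, p.getVert (i + 1 :)) := by
    intro i
    by_cases hi : (i : ℕ) < p.length
    · have : ((i + 1 : Fin (p.length + 1)) : ℕ) = i + 1 :=
        Fin.val_add_one_of_lt (by rwa [Fin.lt_def, Fin.val_last])
      simp only [g, hi, if_true, this]
      exact (hf i hi).2.2
    · have hlast : i = Fin.last _ := Fin.ext (by have := i.2; rw [Fin.val_last]; omega)
      subst hlast
      simp [g, hxy]
  refine ⟨Finset.univ.image g, ⟨p.length, fun i => p.getVert i, g, ?_, ?_, hg, rfl⟩, ?_, ?_⟩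
  · intro i j hij
    exact Fin.ext (hinj (Nat.le_of_lt_succ i.2) (Nat.le_of_lt_succ j.2) hij)
  · have hgd : ∀ i : Fin (p.length + 1), (i : ℕ) < p.length → g i ≠ d := fun i hi => by
      simp only [g, hi, if_true]
      exact (hf i hi).2.1
    have hgl : ∀ i : Fin (p.length + 1), ¬ (i : ℕ) < p.length → g i = d := fun i hi => by
      simp only [g, hi, if_false]
    intro i j hij
    by_cases hi : (i : ℕ) < p.length <;> by_cases hj : (j : ℕ) < p.length
    · have h1 : ends (g i) = ends (g j) := congrArg ends hij
      simp only [g, hi, hj, if_true, (hf i hi).2.2, (hf j hj).2.2] at h1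
      rcases Sym2.eq_iff.1 h1 with ⟨h, -⟩ | ⟨h, h'⟩
      · exact Fin.ext (hinj hi.le hj.le h)
      · have e1 := hinj (x₁ := (i : ℕ)) (x₂ := (j : ℕ) + 1) hi.le hj h
        have e2 := hinj (x₁ := (i : ℕ) + 1) (x₂ := (j : ℕ)) hi hj.le h'
        omega
    · exact absurd (hij.trans (hgl j hj)) (hgd i hi)
    · exact absurd (hij.symm.trans (hgl i hi)) (hgd j hj)
    · exact Fin.ext (by have := i.2; have := j.2; omega)
  · exact Finset.mem_image.2 ⟨Fin.last _, Finset.mem_univ _, by simp [g]⟩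
  · intro e he
    obtain ⟨i, -, rfl⟩ := Finset.mem_image.1 he
    by_cases hi : (i : ℕ) < p.length
    · simp only [g, hi, if_true]
      exact (hf i hi).1
    · simpa only [g, hi, if_false]

theorem cycleSpace_le_of_cycles [Fintype ε] {ends : ε → Sym2 V} {x y : ε → V}
    (hxy : ∀ e, ends e = s(x e, y e)) {B : Submodule (ZMod 2) (ε → ZMod 2)}
    (hB : ∀ C : Finset ε, IsCycle ends C → charVec (C : Set ε) ∈ B) : cycleSpace x y ≤ B := by
  suffices ∀ k, ∀ z ∈ cycleSpace x y, (Finset.univ.filter fun e => z e ≠ 0).card = k → z ∈ B from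
    fun z hz => this _ z hz rfl
  intro k
  induction k using Nat.strong_induction_on with
  | _ k ih =>
    intro z hz hk
    by_cases h0 : z = 0
    · exact h0 ▸ B.zero_mem
    obtain ⟨d, hd⟩ := Function.ne_iff.1 h0
    obtain ⟨C, hC, hdC, hCz⟩ := exists_cycle_of_mem_cycleSpace hxy hz hd
    have hsub : z - charVec (C : Set ε) ∈ cycleSpace x y :=
      Submodule.sub_mem _ hz (hC.charVec_mem hxy)
    have hlt : (Finset.univ.filter fun e => (z - charVec (C : Set ε)) e ≠ 0).card < k := by
      rw [← hk]
      refine Finset.card_lt_card (Finset.ssubset_iff_of_subset ?_ |>.2 ⟨d, ?_, ?_⟩)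
      · intro e he
        simp only [Finset.mem_filter, Finset.mem_univ, true_and, Pi.sub_apply, charVec,
          Finset.mem_coe] at he ⊢
        intro hze
        by_cases heC : e ∈ C
        · exact hCz e heC hze
        · simp [hze, heC] at he
      · simpa using hd
      · simp [charVec, hdC, zmod_two_eq_one hd]
    have := B.add_mem (ih _ hlt _ hsub rfl) (hB C hC)
    simpa using this

/-- If cycles are cuts of `(a, b)` and Euler's formula holds, then the cycle space is the cut space
of `(a, b)`. -/
theorem cycleSpace_eq_range_cob [Fintype V] [Nonempty V] [Fintype ε] {ends : ε → Sym2 V}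
    {x y : ε → V} (hxy : ∀ e, ends e = s(x e, y e)) {n : ℕ} {a b : ε → Fin (n + 1)}
    (hn : n + Fintype.card V = Fintype.card ε + 1)
    (hcut : ∀ C, IsCycle ends C → ∃ S : Set (Fin (n + 1)), ∀ e, e ∈ C ↔ ¬ (a e ∈ S ↔ b e ∈ S)) :
    cycleSpace x y = LinearMap.range (cob a b) := by
  apply Submodule.eq_of_le_of_finrank_le
  · refine cycleSpace_le_of_cycles hxy fun C hC => ?_
    obtain ⟨S, hS⟩ := hcut C hC
    refine ⟨charVec S, ?_⟩
    ext e
    have := hS e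
    simp only [cob_apply, charVec, Finset.mem_coe, this]
    by_cases h1 : a e ∈ S <;> by_cases h2 : b e ∈ S <;> simp [h1, h2]
    decide
  · have h1 := finrank_range_cob_lt a b
    have h2 := le_finrank_cycleSpace x y
    rw [Fintype.card_fin] at h1
    omega

end Duality

section Sparsity

variable {V ε Φ ι : Type}

/-- `S` spans a connected subgraph of the multigraph whose edge `e` joins `a e` and `b e`. -/
def IsConn (a b : ε → Φ) (S : Set Φ) : Prop :=
  ∀ T : Set Φ, (∀ e, a e ∈ S → b e ∈ S → (a e ∈ T ↔ b e ∈ T)) →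
    ∀ f ∈ S, f ∈ T → ∀ g ∈ S, g ∈ T

/-- In an even set of edges of a simple graph, an edge has two further edges at its ends. -/
theorem two_lt_card_of_even {R : Finset ε} {p q : ε → ι} (hne : ∀ e ∈ R, p e ≠ q e)
    (hinj : Set.InjOn (fun e => s(p e, q e)) (R : Set ε)) {r : ε → Prop}
    (heven : ∀ e ∈ R, r e → ∀ i ∈ s(p e, q e), ∃ e' ∈ R, e' ≠ e ∧ r e' ∧ i ∈ s(p e', q e'))
    {e : ε} (he : e ∈ R) (hr : r e) : 2 < (R.filter r).card := by
  obtain ⟨e₁, h₁, hne₁, hr₁, hm₁⟩ := heven e he hr (p e) (by simp)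
  obtain ⟨e₂, h₂, hne₂, hr₂, hm₂⟩ := heven e he hr (q e) (by simp)
  refine Finset.two_lt_card.2 ⟨e, by simp [he, hr], e₁, by simp [h₁, hr₁], e₂, by simp [h₂, hr₂],
    hne₁.symm, hne₂.symm, ?_⟩
  rintro rfl
  exact hne₁ (hinj h₁ he (Sym2.eq_of_ne_mem (hne e he) hm₁ hm₂ (by simp) (by simp)))

/-- Contracting disjoint connected sets of vertices of a planar graph gives at most three times as
many edges as sets, when parallel edges are discarded. Planarity enters through the duality between
the multigraphs `(x, y)` and `(a, b)`. -/
theorem card_le_three_mul_card [Fintype V] [Fintype ε] [Fintype ι] {x y : ε → V} {a b : ε → Φ}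
    (hdual : cycleSpace x y = LinearMap.range (cob a b)) {A : ι → Set Φ}
    (hdisj : ∀ i j f, f ∈ A i → f ∈ A j → i = j) (hcon : ∀ i, IsConn a b (A i))
    {R : Finset ε} {p q : ε → ι} (hp : ∀ e ∈ R, a e ∈ A (p e)) (hq : ∀ e ∈ R, b e ∈ A (q e))
    (hne : ∀ e ∈ R, p e ≠ q e) (hinj : Set.InjOn (fun e => s(p e, q e)) (R : Set ε)) :
    R.card ≤ 3 * Fintype.card ι := by
  let Q : Set ε := {e | e ∉ R ∧ ¬ ∃ i, a e ∈ A i ∧ b e ∈ A i}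
  let N : Submodule (ZMod 2) (ε → ZMod 2) :=
    { carrier := {z | ∀ e ∉ Q, z e = 0}
      add_mem' := fun hz hw e he => by simp [hz e he, hw e he]
      zero_mem' := fun _ _ => rfl
      smul_mem' := fun c z hz e he => by simp [hz e he] }
  let M := (dotForm ε).orthogonal (cycleSpace x y ⊔ N)
  have hMcob : ∀ m ∈ M, ∃ w, m = cob x y w := by
    intro m hm
    have h1 : m ∈ (dotForm ε).orthogonal (cycleSpace x y) :=
      LinearMap.BilinForm.orthogonal_le le_sup_left hm
    rw [cycleSpace, LinearMap.BilinForm.orthogonal_orthogonal dotForm_nondegenerate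
      dotForm_isRefl] at h1
    obtain ⟨w, rfl⟩ := h1
    exact ⟨w, rfl⟩
  have hMQ : ∀ m ∈ M, ∀ e ∈ Q, m e = 0 := by
    intro m hm e he
    have h1 := hm (Pi.single e 1) (Submodule.mem_sup_right fun e' he' => by
      rw [Pi.single_eq_of_ne]
      rintro rfl
      exact he' he)
    change Pi.single e 1 ⬝ᵥ m = 0 at h1
    simpa using h1
  let ρ : (ε → ZMod 2) →ₗ[ZMod 2] (R → ZMod 2) :=
    { toFun := fun z e => z e
      map_add' := fun _ _ => rfl
      map_smul' := fun _ _ => rfl }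
  let T := M.map ρ
  let p' : R → ι := fun e => p e
  let q' : R → ι := fun e => q e
  have hlow : (dotForm R).orthogonal T ≤ LinearMap.range (cob p' q') := by
    intro s hs
    let s' : ε → ZMod 2 := fun e => if h : e ∈ R then s ⟨e, h⟩ else 0
    have hs' : s' ∈ cycleSpace x y ⊔ N := by
      rw [← LinearMap.BilinForm.orthogonal_orthogonal dotForm_nondegenerate dotForm_isRefl
        (cycleSpace x y ⊔ N)]
      intro m hm
      have h1 : ρ m ⬝ᵥ s = 0 := hs (ρ m) ⟨m, hm, rfl⟩
      change m ⬝ᵥ s' = 0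
      rw [← h1, dotProduct, dotProduct, ← Finset.sum_subset (Finset.subset_univ R),
        ← Finset.sum_coe_sort]
      · refine Finset.sum_congr rfl fun e _ => ?_
        simp [s', ρ]
      · intro e _ he
        simp [s', he]
    obtain ⟨z, hz, n, hn, hzn⟩ := Submodule.mem_sup.1 hs'
    rw [hdual] at hz
    obtain ⟨u, rfl⟩ := hz
    have hu : ∀ e ∉ Q, u (a e) + u (b e) = s' e := fun e he => by
      rw [← hzn, Pi.add_apply, hn e he, add_zero, cob_apply]
    have hconst : ∀ i, ∃ t, ∀ f ∈ A i, u f = t := by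
      intro i
      by_cases hi : ∃ f, f ∈ A i
      · obtain ⟨f, hf⟩ := hi
        refine ⟨u f, fun g hg => hcon i {v | u v = u f} (fun e hae hbe => ?_) f hf rfl g hg⟩
        have heR : e ∉ R := fun heR => hne e heR
          ((hdisj _ _ _ (hp e heR) hae).trans (hdisj _ _ _ (hq e heR) hbe).symm)
        have heQ : e ∉ Q := fun heQ => heQ.2 ⟨i, hae, hbe⟩
        have h1 := hu e heQ
        simp only [s', heR, dif_neg, not_false_eq_true] at h1
        rw [CharTwo.add_eq_zero] at h1
        simp only [Set.mem_ofPred_eq, h1]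
      · exact ⟨0, fun f hf => absurd ⟨f, hf⟩ hi⟩
    choose t ht using hconst
    refine ⟨t, ?_⟩
    ext e
    have h1 := hu e fun heQ => heQ.1 e.2
    rw [ht _ _ (hp e e.2), ht _ _ (hq e e.2)] at h1
    simpa [s', cob_apply, p', q'] using h1
  have hrank : R.card ≤ Module.finrank (ZMod 2) T + Fintype.card ι := by
    have h1 := LinearMap.BilinForm.finrank_orthogonal (dotForm_nondegenerate (ε := R)) T
    have h2 := Submodule.finrank_mono hlow
    have h3 := LinearMap.finrank_range_le (cob p' q')
    rw [Module.finrank_fintype_fun_eq_card] at h1 h3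
    rw [Fintype.card_coe] at h1
    omega
  let Γ : SimpleGraph V := SimpleGraph.fromRel fun u v => ∃ e ∈ Q, x e = u ∧ y e = v
  have hΓ : ∀ e ∈ Q, Γ.connectedComponentMk (x e) = Γ.connectedComponentMk (y e) := by
    intro e he
    by_cases h : x e = y e
    · rw [h]
    · exact SimpleGraph.ConnectedComponent.sound
        (SimpleGraph.Adj.reachable ((SimpleGraph.fromRel_adj _ _ _).2
          ⟨h, Or.inl ⟨e, he, rfl, rfl⟩⟩))
  let r : Γ.ConnectedComponent → ε → ZMod 2 := fun c =>
    cob x y fun v => if Γ.connectedComponentMk v = c then 1 else 0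
  have : Fintype Γ.ConnectedComponent := Fintype.ofFinite _
  let 𝒞 : Finset Γ.ConnectedComponent := Finset.univ.filter fun c => ∃ e ∈ R, r c e ≠ 0
  have hup : Module.finrank (ZMod 2) T ≤ 𝒞.card := by
    refine le_trans (Submodule.finrank_mono (t := Submodule.span (ZMod 2)
      ((𝒞.image fun c => ρ (r c) : Finset (R → ZMod 2)) : Set (R → ZMod 2))) ?_)
      ((finrank_span_finset_le_card _).trans Finset.card_image_le)
    rintro _ ⟨m, hm, rfl⟩
    obtain ⟨w, rfl⟩ := hMcob m hm
    have hw : ∀ u v, Γ.Adj u v → w u = w v := by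
      intro u v huv
      have key : ∀ e ∈ Q, w (x e) = w (y e) := fun e he => by
        have := hMQ _ hm e he
        rwa [cob_apply, CharTwo.add_eq_zero] at this
      rcases ((SimpleGraph.fromRel_adj _ _ _).1 huv).2 with ⟨e, he, rfl, rfl⟩ | ⟨e, he, rfl, rfl⟩
      · exact key e he
      · exact (key e he).symm
    have hwr : ∀ u v, Γ.Reachable u v → w u = w v := by
      rintro u v ⟨W⟩
      induction W with
      | nil => rfl
      | cons h _ ih => exact (hw _ _ h).trans ih
    have hsum : cob x y w = ∑ c, (w c.out) • r c := by
      have : w = ∑ c : Γ.ConnectedComponent, (w c.out) •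
          fun v => if Γ.connectedComponentMk v = c then (1 : ZMod 2) else 0 := by
        ext v
        simp only [Finset.sum_apply, Pi.smul_apply, smul_eq_mul, mul_ite, mul_one, mul_zero,
          Finset.sum_ite_eq, Finset.mem_univ, if_true]
        exact hwr _ _ (SimpleGraph.ConnectedComponent.exact (Quot.out_eq _)).symm
      conv_lhs => rw [this]
      simp only [map_sum, map_smul, r]
    rw [hsum, map_sum]
    refine Submodule.sum_mem _ fun c _ => ?_
    rw [map_smul]
    refine Submodule.smul_mem _ _ ?_
    by_cases hc : c ∈ 𝒞
    · exact Submodule.subset_span (Finset.mem_coe.2 (Finset.mem_image_of_mem _ hc))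
    · have : ρ (r c) = 0 := by
        ext e
        by_contra hne
        exact hc (Finset.mem_filter.2 ⟨Finset.mem_univ _, e, e.2, hne⟩)
      rw [this]
      exact Submodule.zero_mem _
  have hrQ : ∀ c, ∀ e ∈ Q, r c e = 0 := fun c e he => by
    simp only [r, cob_apply, hΓ e he, CharTwo.add_self_eq_zero]
  have heven : ∀ c, ∀ e ∈ R, r c e ≠ 0 → ∀ i ∈ s(p e, q e),
      ∃ e' ∈ R, e' ≠ e ∧ r c e' ≠ 0 ∧ i ∈ s(p e', q e') := by
    intro c e he hr i hi
    by_contra! hcon'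
    have hmem : cob a b (charVec (A i)) ∈ cycleSpace x y := hdual ▸ ⟨_, rfl⟩
    have hsum := mem_cycleSpace.1 hmem fun v => if Γ.connectedComponentMk v = c then 1 else 0
    change ∑ e, cob a b (charVec (A i)) e * r c e = 0 at hsum
    have hR : ∀ e ∈ R, (a e ∈ A i ↔ p e = i) ∧ (b e ∈ A i ↔ q e = i) := fun e he =>
      ⟨⟨fun h => hdisj _ _ _ (hp e he) h, fun h => h ▸ hp e he⟩,
        ⟨fun h => hdisj _ _ _ (hq e he) h, fun h => h ▸ hq e he⟩⟩
    rw [Finset.sum_eq_single e] at hsum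
    · refine mul_ne_zero ?_ hr hsum
      simp only [cob_apply, charVec, hR e he]
      have := hne e he
      rcases Sym2.mem_iff.1 hi with rfl | rfl
      · simp [this.symm]
      · simp [this]
    · intro e' _ hee'
      by_cases heQ : e' ∈ Q
      · rw [hrQ c e' heQ, mul_zero]
      by_cases heR : e' ∈ R
      · by_cases hr' : r c e' = 0
        · rw [hr', mul_zero]
        have h1 := hcon' e' heR hee' hr'
        simp only [Sym2.mem_iff, not_or] at h1
        simp [cob_apply, charVec, hR e' heR, Ne.symm h1.1, Ne.symm h1.2]
      · obtain ⟨j, hj, hj'⟩ : ∃ j, a e' ∈ A j ∧ b e' ∈ A j := by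
          by_contra hn
          exact heQ ⟨heR, hn⟩
        have : a e' ∈ A i ↔ b e' ∈ A i :=
          ⟨fun h => hdisj _ _ _ hj h ▸ hj', fun h => hdisj _ _ _ hj' h ▸ hj⟩
        simp only [cob_apply, charVec, this, CharTwo.add_self_eq_zero, zero_mul]
    · simp
  have hcount : 𝒞.card * 3 ≤ R.card * 2 := by
    refine Finset.card_mul_le_card_mul (fun c e => r c e ≠ 0) ?_ ?_
    · intro c hc
      obtain ⟨e, he, hr⟩ := (Finset.mem_filter.1 hc).2
      have := two_lt_card_of_even hne hinj (r := fun e => r c e ≠ 0) (heven c) he hr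
      refine this.trans_le (le_of_eq ?_)
      congr
    · intro e he
      refine (Finset.card_le_card (t := {Γ.connectedComponentMk (x e),
        Γ.connectedComponentMk (y e)}) ?_).trans Finset.card_le_two
      intro c hc
      have hr := (Finset.mem_filter.1 hc).2
      simp only [r, cob_apply] at hr
      by_contra hn
      simp only [Finset.mem_insert, Finset.mem_singleton, not_or] at hn
      simp [Ne.symm hn.1, Ne.symm hn.2] at hr
  omega

end Sparsity

section Independent

variable {V ε Φ ι : Type}

/-- The edge `e` of the multigraph `(a, b)` has exactly one end in `S`. -/
def Crosses (a b : ε → Φ) (e : ε) (S : Set Φ) : Prop := ¬ (a e ∈ S ↔ b e ∈ S)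

/-- If every induced subgraph has a vertex of degree at most `k`, there is an independent set
containing a fraction `1 / (k + 1)` of the vertices. -/
theorem exists_independent {adj : ι → ι → Prop} (hsymm : ∀ i j, adj i j → adj j i) {k : ℕ}
    (hdeg : ∀ J : Finset ι, J.Nonempty →
      ∃ i ∈ J, (J.filter fun j => j ≠ i ∧ adj i j).card ≤ k) (J : Finset ι) :
    ∃ I ⊆ J, (∀ i ∈ I, ∀ j ∈ I, i ≠ j → ¬ adj i j) ∧ J.card ≤ (k + 1) * I.card := by
  induction J using Finset.strongInduction with
  | H J ih =>
    rcases J.eq_empty_or_nonempty with rfl | hJ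
    · exact ⟨∅, by simp⟩
    obtain ⟨i, hi, hk⟩ := hdeg J hJ
    let J' := J.filter fun j => j ≠ i ∧ ¬ adj i j
    have hJ' : J' ⊂ J := Finset.filter_ssubset.2 ⟨i, hi, by simp⟩
    obtain ⟨I, hIJ, hI, hcard⟩ := ih J' hJ'
    have hiI : i ∉ I := fun h => by simpa [J'] using hIJ h
    refine ⟨insert i I, Finset.insert_subset hi (hIJ.trans hJ'.1), ?_, ?_⟩
    · intro u hu v hv huv
      rcases Finset.mem_insert.1 hu with rfl | hu' <;> rcases Finset.mem_insert.1 hv with rfl | hv'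
      · exact absurd rfl huv
      · exact (Finset.mem_filter.1 (hIJ hv')).2.2
      · exact fun h => (Finset.mem_filter.1 (hIJ hu')).2.2 (hsymm _ _ h)
      · exact hI u hu' v hv' huv
    · have hsub : J ⊆ insert i ((J.filter fun j => j ≠ i ∧ adj i j) ∪ J') := by
        intro j hj
        by_cases h1 : j = i <;> by_cases h2 : adj i j <;> simp [J', hj, h1, h2]
      have h1 := (Finset.card_le_card hsub).trans (Finset.card_insert_le _ _)
      have h2 := Finset.card_union_le (J.filter fun j => j ≠ i ∧ adj i j) J'
      rw [Finset.card_insert_of_notMem hiI]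
      nlinarith

theorem exists_degree_le_six [Fintype V] [Fintype ε] [Fintype ι] [Nonempty ι] {x y : ε → V}
    {a b : ε → Φ} (hdual : cycleSpace x y = LinearMap.range (cob a b)) {A : ι → Set Φ}
    (hdisj : ∀ i j f, f ∈ A i → f ∈ A j → i = j) (hcon : ∀ i, IsConn a b (A i))
    {adj : ι → ι → Prop} (hadj : ∀ i j, adj i j → ∃ e, Crosses a b e (A i) ∧ Crosses a b e (A j)) :
    ∃ i, (Finset.univ.filter fun j => j ≠ i ∧ adj i j).card ≤ 6 := by
  let P : Finset (ι × ι) := Finset.univ.filter fun t => t.2 ≠ t.1 ∧ adj t.1 t.2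
  have hchoice : ∀ e, ∃ t : ι × ι, (∃ t : ι × ι, t.1 ≠ t.2 ∧ a e ∈ A t.1 ∧ b e ∈ A t.2) →
      t.1 ≠ t.2 ∧ a e ∈ A t.1 ∧ b e ∈ A t.2 := by
    intro e
    by_cases h : ∃ t : ι × ι, t.1 ≠ t.2 ∧ a e ∈ A t.1 ∧ b e ∈ A t.2
    · exact ⟨h.choose, fun _ => h.choose_spec⟩
    · exact ⟨Classical.arbitrary _, fun h' => absurd h' h⟩
  choose φ hφ using hchoice
  let X : Set ε := {e | ∃ t : ι × ι, t.1 ≠ t.2 ∧ a e ∈ A t.1 ∧ b e ∈ A t.2}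
  have hsurj : Set.SurjOn (fun e => s((φ e).1, (φ e).2)) X
      ((P.image fun t => s(t.1, t.2) : Finset (Sym2 ι)) : Set (Sym2 ι)) := by
    intro s hs
    obtain ⟨⟨i, j⟩, ht, rfl⟩ := Finset.mem_image.1 (Finset.mem_coe.1 hs)
    obtain ⟨hij, hadj'⟩ := (Finset.mem_filter.1 ht).2
    obtain ⟨e, hi, hj⟩ := hadj i j hadj'
    have hex : (a e ∈ A i ∧ b e ∈ A j) ∨ (a e ∈ A j ∧ b e ∈ A i) := by
      have h1 : ¬ (a e ∈ A i ∧ a e ∈ A j) := fun h => hij (hdisj _ _ _ h.2 h.1)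
      have h2 : ¬ (b e ∈ A i ∧ b e ∈ A j) := fun h => hij (hdisj _ _ _ h.2 h.1)
      unfold Crosses at hi hj
      tauto
    rcases hex with ⟨h1, h2⟩ | ⟨h1, h2⟩
    · have hX : e ∈ X := ⟨(i, j), Ne.symm hij, h1, h2⟩
      obtain ⟨-, h3, h4⟩ := hφ e hX
      exact ⟨e, hX, by simp only [hdisj _ _ _ h3 h1, hdisj _ _ _ h4 h2]⟩
    · have hX : e ∈ X := ⟨(j, i), hij, h1, h2⟩
      obtain ⟨-, h3, h4⟩ := hφ e hX
      exact ⟨e, hX, by simp only [hdisj _ _ _ h3 h1, hdisj _ _ _ h4 h2, Sym2.eq_swap]⟩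
  obtain ⟨R, hRX, hinj, hR⟩ := Finset.exists_subset_injOn_image_eq_of_surjOn _ _ hsurj
  have hcardR : R.card ≤ 3 * Fintype.card ι :=
    card_le_three_mul_card hdual hdisj hcon (p := fun e => (φ e).1) (q := fun e => (φ e).2)
      (fun e he => (hφ e (hRX he)).2.1) (fun e he => (hφ e (hRX he)).2.2)
      (fun e he => (hφ e (hRX he)).1) hinj
  have hP : P.card ≤ 2 * R.card := by
    rw [← Finset.card_image_of_injOn hinj, hR]
    refine Finset.card_le_mul_card_image _ _ fun s hs => ?_
    obtain ⟨⟨i, j⟩, ht, rfl⟩ := Finset.mem_image.1 hs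
    refine (Finset.card_le_card (t := {(i, j), (j, i)}) ?_).trans Finset.card_le_two
    rintro ⟨u, v⟩ huv
    have := (Finset.mem_filter.1 huv).2
    simpa using this
  have hsum : P.card = ∑ i, (Finset.univ.filter fun j => j ≠ i ∧ adj i j).card := by
    simp only [P, Finset.card_filter, Fintype.sum_prod_type]
  by_contra! hcon'
  have : ∑ _i : ι, 7 ≤ ∑ i, (Finset.univ.filter fun j => j ≠ i ∧ adj i j).card :=
    Finset.sum_le_sum fun i _ => hcon' i
  rw [Finset.sum_const, Finset.card_univ, smul_eq_mul] at this
  have := Fintype.card_pos (α := ι)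
  omega

/-- A family of disjoint connected sets of vertices has a large subfamily without two sets joined by
an edge of `E`. -/
theorem exists_independent_cuts [Fintype V] [Fintype ε] {x y : ε → V}
    {a b : ε → Φ} (hdual : cycleSpace x y = LinearMap.range (cob a b)) (E : Set ε)
    (𝒜 : Finset (Set Φ)) (hdisj : ∀ A ∈ 𝒜, ∀ B ∈ 𝒜, ∀ f, f ∈ A → f ∈ B → A = B)
    (hcon : ∀ A ∈ 𝒜, IsConn a b A) :
    ∃ ℐ ⊆ 𝒜, (∀ A ∈ ℐ, ∀ B ∈ ℐ, A ≠ B → ∀ e ∈ E, ¬ (Crosses a b e A ∧ Crosses a b e B)) ∧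
      𝒜.card ≤ 7 * ℐ.card := by
  let adj : 𝒜 → 𝒜 → Prop := fun A B => ∃ e ∈ E, Crosses a b e (A : Set Φ) ∧ Crosses a b e B
  obtain ⟨I, -, hI, hcard⟩ := exists_independent (adj := adj) (k := 6)
    (fun A B ⟨e, he, h1, h2⟩ => ⟨e, he, h2, h1⟩) (fun J hJ => by
      have : Nonempty J := hJ.to_subtype
      obtain ⟨i, hi⟩ := exists_degree_le_six (ι := J) hdual (A := fun i => ((i : 𝒜) : Set Φ))
        (fun i j f h1 h2 => Subtype.ext (Subtype.ext (hdisj _ i.1.2 _ j.1.2 f h1 h2)))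
        (fun i => hcon _ i.1.2) (adj := fun i j => adj i j) fun i j ⟨e, _, h⟩ => ⟨e, h⟩
      refine ⟨i, i.2, le_trans ?_ hi⟩
      refine Finset.card_le_card_of_surjOn (fun j => (j : 𝒜)) fun j hj => ?_
      simp only [Finset.coe_filter, Set.mem_ofPred_eq] at hj
      refine ⟨⟨j, hj.1⟩, ?_, rfl⟩
      simp only [Finset.coe_filter, Set.mem_ofPred_eq]
      exact ⟨Finset.mem_univ _, fun h => hj.2.1 (congrArg Subtype.val h), hj.2.2⟩) Finset.univ
  refine ⟨I.map (Function.Embedding.subtype _), fun A hA => ?_, fun A hA B hB hAB e he h => ?_, ?_⟩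
  · obtain ⟨A, -, rfl⟩ := Finset.mem_map.1 hA
    exact A.2
  · obtain ⟨A', hA', rfl⟩ := Finset.mem_map.1 hA
    obtain ⟨B', hB', rfl⟩ := Finset.mem_map.1 hB
    exact hI A' hA' B' hB' (fun h => hAB (h ▸ rfl)) ⟨e, he, h⟩
  · rw [Finset.card_map]
    simpa using hcard

end Independent

section Packing

variable {V ε Φ : Type} {a b : ε → Φ} {D X : Set ε} {A B S T : Set Φ}

/-- The sets of vertices whose boundary contains exactly one edge of `D` and none of `X`. -/
def unitCuts (a b : ε → Φ) (D X : Set ε) : Set (Set Φ) :=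
  {S | (∀ e ∈ X, ¬ Crosses a b e S) ∧ ∃ d ∈ D, Crosses a b d S ∧ ∀ e ∈ D, Crosses a b e S → e = d}

theorem nonempty_of_mem_unitCuts (hS : S ∈ unitCuts a b D X) : S.Nonempty := by
  obtain ⟨-, d, -, hd, -⟩ := hS
  by_contra h
  rw [Set.not_nonempty_iff_eq_empty] at h
  simp [Crosses, h] at hd

theorem uncross (hA : A ∈ unitCuts a b D X) (hB : B ∈ unitCuts a b D X) :
    (A ∩ B ∈ unitCuts a b D X ∧ A ∪ B ∈ unitCuts a b D X) ∨
      (A \ B ∈ unitCuts a b D X ∧ B \ A ∈ unitCuts a b D X) := by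
  obtain ⟨hAX, d, hd, hdA, hA⟩ := hA
  obtain ⟨hBX, f, hf, hfB, hB⟩ := hB
  have key : ∀ S : Set Φ, (∀ e, Crosses a b e S → Crosses a b e A ∨ Crosses a b e B) →
      (Crosses a b d S ∨ Crosses a b f S) → (Crosses a b d S → Crosses a b f S → d = f) →
      S ∈ unitCuts a b D X := by
    intro S h1 h2 h3
    refine ⟨fun e he h => (h1 e h).elim (hAX e he) (hBX e he), ?_⟩
    rcases h2 with h2 | h2
    · refine ⟨d, hd, h2, fun e he h => (h1 e h).elim (hA e he) fun h' => ?_⟩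
      rcases hB e he h' with rfl
      exact (h3 h2 h).symm
    · refine ⟨f, hf, h2, fun e he h => (h1 e h).elim (fun h' => ?_) (hB e he)⟩
      rcases hA e he h' with rfl
      exact h3 h h2
  have h1 : ∀ e, Crosses a b e (A ∩ B) → Crosses a b e A ∨ Crosses a b e B := by
    intro e; simp only [Crosses, Set.mem_inter_iff]; tauto
  have h2 : ∀ e, Crosses a b e (A ∪ B) → Crosses a b e A ∨ Crosses a b e B := by
    intro e; simp only [Crosses, Set.mem_union]; tauto
  have h3 : ∀ e, Crosses a b e (A \ B) → Crosses a b e A ∨ Crosses a b e B := by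
    intro e; simp only [Crosses, Set.mem_sdiff]; tauto
  have h4 : ∀ e, Crosses a b e (B \ A) → Crosses a b e A ∨ Crosses a b e B := by
    intro e; simp only [Crosses, Set.mem_sdiff]; tauto
  have hdB := hB d hd
  have hfA := hA f hf
  suffices h : ((Crosses a b d (A ∩ B) ∨ Crosses a b f (A ∩ B)) ∧
      (Crosses a b d (A ∩ B) → Crosses a b f (A ∩ B) → d = f) ∧
      (Crosses a b d (A ∪ B) ∨ Crosses a b f (A ∪ B)) ∧
      (Crosses a b d (A ∪ B) → Crosses a b f (A ∪ B) → d = f)) ∨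
      ((Crosses a b d (A \ B) ∨ Crosses a b f (A \ B)) ∧
      (Crosses a b d (A \ B) → Crosses a b f (A \ B) → d = f) ∧
      (Crosses a b d (B \ A) ∨ Crosses a b f (B \ A)) ∧
      (Crosses a b d (B \ A) → Crosses a b f (B \ A) → d = f)) from
    h.imp (fun h => ⟨key _ h1 h.1 h.2.1, key _ h2 h.2.2.1 h.2.2.2⟩)
      fun h => ⟨key _ h3 h.1 h.2.1, key _ h4 h.2.2.1 h.2.2.2⟩
  clear key h1 h2 h3 h4 hAX hBX hA hB
  by_cases hdf : d = f
  · subst hdf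
    simp only [Crosses, Set.mem_inter_iff, Set.mem_union, Set.mem_sdiff, implies_true, and_true,
      or_self] at *
    grind
  · replace hdB : ¬ Crosses a b d B := fun h => hdf (hdB h)
    replace hfA : ¬ Crosses a b f A := fun h => hdf (hfA h).symm
    simp only [Crosses, Set.mem_inter_iff, Set.mem_union, Set.mem_sdiff, hdf] at *
    grind

theorem subset_or_disjoint (hA : Minimal (· ∈ unitCuts a b D X) A) (hT : T ∈ unitCuts a b D X) :
    A ⊆ T ∨ Disjoint A T := by
  rcases uncross hA.prop hT with h | h
  · exact Or.inl (Set.inter_eq_left.1 (hA.eq_of_le h.1 Set.inter_subset_left))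
  · exact Or.inr (sdiff_eq_left.1 (hA.eq_of_le h.1 Set.sdiff_subset))

theorem eq_of_mem_of_mem (hA : Minimal (· ∈ unitCuts a b D X) A)
    (hB : Minimal (· ∈ unitCuts a b D X) B) {f : Φ} (hfA : f ∈ A) (hfB : f ∈ B) : A = B := by
  rcases subset_or_disjoint hA hB.prop with h | h
  · exact hB.eq_of_le hA.prop h
  · exact absurd hfB (Set.disjoint_left.1 h hfA)

theorem isConn_of_minimal (hA : Minimal (· ∈ unitCuts a b D X) A) : IsConn a b A := by
  intro T hT f hfA hfT g hgA
  obtain ⟨hX, d, hd, hdA, hdu⟩ := hA.prop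
  have key : ∀ S : Set Φ, (∀ e, Crosses a b e S → Crosses a b e A) → Crosses a b d S →
      S ∈ unitCuts a b D X := fun S h1 h2 =>
    ⟨fun e he h => hX e he (h1 e h), d, hd, h2, fun e he h => hdu e he (h1 e h)⟩
  have h1 : ∀ e, Crosses a b e (A ∩ T) → Crosses a b e A := by
    intro e
    have := hT e
    simp only [Crosses, Set.mem_inter_iff]
    tauto
  have h2 : ∀ e, Crosses a b e (A \ T) → Crosses a b e A := by
    intro e
    have := hT e
    simp only [Crosses, Set.mem_sdiff]
    tauto
  have h3 : Crosses a b d (A ∩ T) ∨ Crosses a b d (A \ T) := by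
    simp only [Crosses, Set.mem_inter_iff, Set.mem_sdiff] at *
    tauto
  rcases h3 with h | h
  · exact (Set.inter_eq_left.1 (hA.eq_of_le (key _ h1 h) Set.inter_subset_left)) hgA
  · have := sdiff_eq_left.1 (hA.eq_of_le (key _ h2 h) Set.sdiff_subset)
    exact absurd hfT (Set.disjoint_left.1 this hfA)

/-- `S` is a cut whose only edge in `F` is `e`. -/
def IsWitness (a b : ε → Φ) (D X : Set ε) (F : Finset ε) (e : ε) (S : Set Φ) : Prop :=
  S ∈ unitCuts a b D X ∧ ∀ f ∈ F, Crosses a b f S ↔ f = e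

theorem laminar_of_min_witness [Finite Φ] {F : Finset ε}
    (hcov : ∀ S ∈ unitCuts a b D X, ∃ e ∈ F, Crosses a b e S) {e f : ε} (he : e ∈ F) (hf : f ∈ F)
    (hef : e ≠ f) (hA : IsWitness a b D X F e A) (hB : IsWitness a b D X F f B)
    (hAmin : ∀ S, IsWitness a b D X F e S → A.ncard ≤ S.ncard)
    (hBmin : ∀ S, IsWitness a b D X F f S → B.ncard ≤ S.ncard) :
    A ⊆ B ∨ B ⊆ A ∨ Disjoint A B := by
  have heA := (hA.2 e he).2 rfl
  have hfB := (hB.2 f hf).2 rfl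
  have heB : ¬ Crosses a b e B := fun h => hef ((hB.2 e he).1 h)
  have hfA : ¬ Crosses a b f A := fun h => hef ((hA.2 f hf).1 h).symm
  have hcross : ∀ S ∈ unitCuts a b D X,
      (∀ e, Crosses a b e S → Crosses a b e A ∨ Crosses a b e B) →
      (Crosses a b e S ∨ Crosses a b f S) ∧
      (¬ Crosses a b f S → IsWitness a b D X F e S) ∧
      (¬ Crosses a b e S → IsWitness a b D X F f S) := by
    intro S hS h
    have h1 : ∀ g ∈ F, Crosses a b g S → g = e ∨ g = f := fun g hg h' =>
      (h g h').imp (hA.2 g hg).1 (hB.2 g hg).1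
    have h2 : Crosses a b e S ∨ Crosses a b f S := by
      obtain ⟨g, hg, h'⟩ := hcov S hS
      rcases h1 g hg h' with rfl | rfl
      · exact Or.inl h'
      · exact Or.inr h'
    refine ⟨h2, fun h3 => ⟨hS, fun g hg => ⟨fun h' => ?_, ?_⟩⟩,
      fun h3 => ⟨hS, fun g hg => ⟨fun h' => ?_, ?_⟩⟩⟩
    · exact (h1 g hg h').resolve_right fun h4 => h3 (h4 ▸ h')
    · rintro rfl
      exact h2.resolve_right h3
    · exact (h1 g hg h').resolve_left fun h4 => h3 (h4 ▸ h')
    · rintro rfl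
      exact h2.resolve_left h3
  rcases uncross hA.1 hB.1 with ⟨h1, h2⟩ | ⟨h1, h2⟩
  · obtain ⟨hi, hie, hif⟩ := hcross _ h1 (by
      intro e; simp only [Crosses, Set.mem_inter_iff]; tauto)
    obtain ⟨hu, -, -⟩ := hcross _ h2 (by
      intro e; simp only [Crosses, Set.mem_union]; tauto)
    have hor : ¬ Crosses a b f (A ∩ B) ∨ ¬ Crosses a b e (A ∩ B) := by
      simp only [Crosses, Set.mem_inter_iff, Set.mem_union] at *
      grind
    rcases hor with h | h
    · left
      have := Set.eq_of_subset_of_ncard_le Set.inter_subset_left (hAmin _ (hie h))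
      exact Set.inter_eq_left.1 this
    · right; left
      have := Set.eq_of_subset_of_ncard_le Set.inter_subset_right (hBmin _ (hif h))
      exact Set.inter_eq_right.1 this
  · right; right
    obtain ⟨hi, hie, hif⟩ := hcross _ h1 (by
      intro e; simp only [Crosses, Set.mem_sdiff]; tauto)
    obtain ⟨hu, hue, huf⟩ := hcross _ h2 (by
      intro e; simp only [Crosses, Set.mem_sdiff]; tauto)
    have hor : ¬ Crosses a b f (A \ B) ∨ (¬ Crosses a b e (A \ B) ∧ ¬ Crosses a b f (B \ A)) := by
      simp only [Crosses, Set.mem_sdiff] at *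
      grind
    rcases hor with h | ⟨h, h'⟩
    · have := Set.eq_of_subset_of_ncard_le Set.sdiff_subset (hAmin _ (hie h))
      exact sdiff_eq_left.1 this
    · have h3 := hBmin _ (hif h)
      have h4 := hAmin _ (hue h')
      have h5 : (A \ B).ncard ≤ A.ncard := Set.ncard_le_ncard Set.sdiff_subset
      have := Set.eq_of_subset_of_ncard_le Set.sdiff_subset (h3.trans (h5.trans h4))
      exact (sdiff_eq_left.1 this).symm

theorem exists_minimal_subset [Finite Φ] (hS : S ∈ unitCuts a b D X) :
    ∃ A ⊆ S, Minimal (· ∈ unitCuts a b D X) A :=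
  (Set.toFinite (unitCuts a b D X)).exists_le_minimal hS

theorem Crosses.of_subset {e : ε} (hA : Crosses a b e A) (hAS : A ⊆ S) (hST : S ⊆ T)
    (hT : Crosses a b e T) : Crosses a b e S := by
  have h1 := @hAS (a e)
  have h2 := @hAS (b e)
  have h3 := @hST (a e)
  have h4 := @hST (b e)
  unfold Crosses at *
  grind

theorem exists_mem_of_not_crosses {e : ε} (hA : Crosses a b e A) (hB : Crosses a b e B)
    (hAB : Disjoint A B) (hS : ¬ Crosses a b e S) (hBS : B ⊆ S) : ∃ f ∈ A, f ∈ S := by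
  have h1 := @hBS (a e)
  have h2 := @hBS (b e)
  have h3 := @Set.disjoint_left.1 hAB (a e)
  have h4 := @Set.disjoint_left.1 hAB (b e)
  unfold Crosses at *
  by_cases h5 : a e ∈ A
  · exact ⟨a e, h5, by grind⟩
  · exact ⟨b e, by grind, by grind⟩

/-- The edges of a minimal cover of the unit cuts cross few minimal unit cuts. -/
theorem card_cover_crossing_le [Finite Φ] {F : Finset ε}
    (hcov : ∀ S ∈ unitCuts a b D X, ∃ e ∈ F, Crosses a b e S)
    (hwit : ∀ e ∈ F, ∃ S, IsWitness a b D X F e S) {𝒜 : Finset (Set Φ)}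
    (h𝒜 : ∀ A, A ∈ 𝒜 ↔ Minimal (· ∈ unitCuts a b D X) A) :
    (F.filter fun e => ∃ A ∈ 𝒜, Crosses a b e A).card ≤ 2 * 𝒜.card := by
  have hex : ∀ e ∈ F, ∃ W, IsWitness a b D X F e W ∧
      ∀ S, IsWitness a b D X F e S → W.ncard ≤ S.ncard := fun e he =>
    Set.exists_min_image {S | IsWitness a b D X F e S} Set.ncard (Set.toFinite _) (hwit e he)
  choose! W hW hWmin using hex
  have hcr : ∀ e ∈ F, Crosses a b e (W e) := fun e he => ((hW e he).2 e he).2 rfl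
  have huniq : ∀ e ∈ F, ∀ f ∈ F, Crosses a b f (W e) → f = e := fun e he f hf =>
    ((hW e he).2 f hf).1
  have hlam : ∀ e ∈ F, ∀ f ∈ F, ∀ g, g ∈ W e → g ∈ W f → W e ⊆ W f ∨ W f ⊆ W e := by
    intro e he f hf g hge hgf
    by_cases hef : e = f
    · exact Or.inl (hef ▸ Set.Subset.rfl)
    rcases laminar_of_min_witness hcov he hf hef (hW e he) (hW f hf) (hWmin e he) (hWmin f hf)
      with h | h | h
    · exact Or.inl h
    · exact Or.inr h
    · exact absurd hgf (Set.disjoint_left.1 h hge)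
  have hne : ∀ A ∈ 𝒜, ∃ g, g ∈ A := fun A hA => nonempty_of_mem_unitCuts ((h𝒜 A).1 hA).prop
  let F₁ := F.filter fun e => ∃ A ∈ 𝒜, Crosses a b e A ∧ A ⊆ W e
  let F₂ := F.filter fun e => ∃ A ∈ 𝒜, Crosses a b e A ∧ Disjoint A (W e)
  have hF₁ : F₁.card ≤ 𝒜.card := by
    have : ∀ e ∈ F₁, ∃ A ∈ 𝒜, Crosses a b e A ∧ A ⊆ W e := fun e he => (Finset.mem_filter.1 he).2
    choose! α hα hcross hsub using this
    refine Finset.card_le_card_of_injOn α hα ?_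
    have key : ∀ e ∈ F₁, ∀ f ∈ F₁, α e = α f → W e ⊆ W f → e = f := by
      intro e he f hf h hef
      refine (huniq e (Finset.mem_filter.1 he).1 f (Finset.mem_filter.1 hf).1 ?_).symm
      exact (hcross f hf).of_subset (h ▸ hsub e he) hef (hcr f (Finset.mem_filter.1 hf).1)
    intro e he f hf h
    obtain ⟨g, hg⟩ := hne _ (hα e he)
    rcases hlam e (Finset.mem_filter.1 he).1 f (Finset.mem_filter.1 hf).1 g (hsub e he hg)
      (hsub f hf (h ▸ hg)) with h' | h'
    · exact key e he f hf h h'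
    · exact (key f hf e he h.symm h').symm
  have hF₂ : F₂.card ≤ 𝒜.card := by
    have : ∀ e ∈ F₂, ∃ A ∈ 𝒜, A ⊆ W e ∧ ∀ g ∈ F₂, A ⊆ W g → ¬ W g ⊂ W e := by
      intro e he
      have heF := (Finset.mem_filter.1 he).1
      rcases (F₂.filter fun f => W f ⊂ W e).eq_empty_or_nonempty with h | h
      · obtain ⟨A, hA, hmin⟩ := exists_minimal_subset (hW e heF).1
        exact ⟨A, (h𝒜 A).2 hmin, hA, fun g hg _ => Finset.filter_eq_empty_iff.1 h hg⟩
      · obtain ⟨f, hf, hmax⟩ := Finset.exists_max_image _ (fun f => (W f).ncard) h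
        obtain ⟨hf, hfe⟩ := Finset.mem_filter.1 hf
        obtain ⟨hfF, A, hA, hfA, hdisj⟩ := Finset.mem_filter.1 hf
        have hfW := hcr f hfF
        refine ⟨A, hA, ?_, fun g hg hAg hge => ?_⟩
        · obtain ⟨g, hgA, hge⟩ := exists_mem_of_not_crosses hfA hfW hdisj
            (fun h => hfe.ne (huniq e heF f hfF h ▸ rfl)) hfe.subset
          refine (subset_or_disjoint ((h𝒜 A).1 hA) (hW e heF).1).resolve_right fun h => ?_
          exact Set.disjoint_left.1 h hgA hge
        · have hgF := (Finset.mem_filter.1 hg).1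
          have hfg : ¬ Crosses a b f (W g) := by
            intro h
            obtain ⟨c, hc⟩ := hne A hA
            rw [← huniq g hgF f hfF h] at hAg
            exact Set.disjoint_left.1 hdisj hc (hAg hc)
          obtain ⟨c, hc⟩ := hne A hA
          have hnot : ¬ W g ⊆ W f := fun h => Set.disjoint_left.1 hdisj hc (h (hAg hc))
          obtain ⟨c', h1, h2⟩ := exists_mem_of_not_crosses hfW hfA hdisj.symm hfg hAg
          have hss : W f ⊂ W g := ⟨(hlam f hfF g hgF c' h1 h2).resolve_right hnot, hnot⟩
          have := hmax g (Finset.mem_filter.2 ⟨hg, hge⟩)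
          exact absurd (Set.ncard_lt_ncard hss) this.not_gt
    choose! α hα hsub hlow using this
    refine Finset.card_le_card_of_injOn α hα fun e he f hf h => ?_
    have heF := (Finset.mem_filter.1 he).1
    have hfF := (Finset.mem_filter.1 hf).1
    obtain ⟨g, hg⟩ := hne _ (hα e he)
    have hWeq : W e = W f := by
      rcases hlam e heF f hfF g (hsub e he hg) (hsub f hf (h ▸ hg)) with h' | h'
      · by_contra hne
        exact hlow f hf e he (h ▸ hsub e he) (h'.ssubset_of_ne hne)
      · by_contra hne
        exact hlow e he f hf (h ▸ hsub f hf) (h'.ssubset_of_ne (Ne.symm hne))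
    exact huniq f hfF e heF (hWeq ▸ hcr e heF)
  have hsub : (F.filter fun e => ∃ A ∈ 𝒜, Crosses a b e A) ⊆ F₁ ∪ F₂ := by
    intro e he
    obtain ⟨he, A, hA, hc⟩ := Finset.mem_filter.1 he
    rw [Finset.mem_union]
    rcases subset_or_disjoint ((h𝒜 A).1 hA) (hW e he).1 with h | h
    · exact Or.inl (Finset.mem_filter.2 ⟨he, A, hA, hc, h⟩)
    · exact Or.inr (Finset.mem_filter.2 ⟨he, A, hA, hc, h⟩)
  have := (Finset.card_le_card hsub).trans (Finset.card_union_le _ _)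
  omega

/-- Approximate duality between covering and packing unit cuts in a planar graph. -/
theorem exists_cover_packing [Fintype V] [Fintype ε] [Finite Φ] {x y : ε → V}
    (hdual : cycleSpace x y = LinearMap.range (cob a b))
    (hD : ∀ S ∈ unitCuts a b D ∅, ∃ e, e ∉ D ∧ Crosses a b e S) (X : Set ε) :
    ∃ (F : Finset ε) (ℛ : Finset (Set Φ)), (∀ e ∈ F, e ∉ D) ∧
      (∀ S ∈ unitCuts a b D X, ∃ e ∈ F, Crosses a b e S) ∧
      (∀ S ∈ ℛ, S ∈ unitCuts a b D X) ∧
      (∀ S ∈ ℛ, ∀ T ∈ ℛ, S ≠ T → ∀ e, e ∉ D → ¬ (Crosses a b e S ∧ Crosses a b e T)) ∧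
      F.card ≤ 14 * ℛ.card := by
  induction hn : Xᶜ.ncard using Nat.strong_induction_on generalizing X with
  | _ n ih =>
  subst hn
  rcases (unitCuts a b D X).eq_empty_or_nonempty with h0 | ⟨S₀, hS₀⟩
  · exact ⟨∅, ∅, by simp [h0]⟩
  let 𝒜 : Finset (Set Φ) := (Set.toFinite {A | Minimal (· ∈ unitCuts a b D X) A}).toFinset
  have h𝒜 : ∀ A, A ∈ 𝒜 ↔ Minimal (· ∈ unitCuts a b D X) A := fun A => by simp [𝒜]
  let N : Set ε := {e | e ∉ D ∧ ∃ A ∈ 𝒜, Crosses a b e A}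
  have hcross : ∀ S ∈ unitCuts a b D X, ∃ e, e ∉ D ∧ Crosses a b e S := fun S hS =>
    hD S ⟨by simp, hS.2⟩
  have hXX : Xᶜ ⊃ (X ∪ N)ᶜ := by
    obtain ⟨A, -, hA⟩ := exists_minimal_subset hS₀
    obtain ⟨e, heD, he⟩ := hcross A hA.prop
    rw [gt_iff_lt, Set.ssubset_iff_exists]
    refine ⟨Set.compl_subset_compl.2 Set.subset_union_left, e, fun h => hA.prop.1 e h he, ?_⟩
    exact fun h => h (Or.inr ⟨heD, A, (h𝒜 A).2 hA, he⟩)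
  obtain ⟨F', ℛ, hF'D, hF', hℛ, hdisj, hcard⟩ := ih _ (Set.ncard_lt_ncard hXX) (X ∪ N) rfl
  obtain ⟨ℐ, hℐ𝒜, hℐ, hℐcard⟩ := exists_independent_cuts hdual {e | e ∉ D} 𝒜
    (fun A hA B hB f => eq_of_mem_of_mem ((h𝒜 A).1 hA) ((h𝒜 B).1 hB))
    (fun A hA => isConn_of_minimal ((h𝒜 A).1 hA))
  let covers : Set (Finset ε) := {F | ∀ S ∈ unitCuts a b D X, ∃ e ∈ F, Crosses a b e S}
  have h0 : F' ∪ N.toFinset ∈ covers := by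
    intro S hS
    by_cases h : ∃ e ∈ N, Crosses a b e S
    · obtain ⟨e, he, h⟩ := h
      exact ⟨e, by simp [he], h⟩
    · push Not at h
      obtain ⟨e, he, h'⟩ := hF' S ⟨fun e he => he.elim (hS.1 e) (h e), hS.2⟩
      exact ⟨e, by simp [he], h'⟩
  obtain ⟨F, hFle, hF⟩ := (Set.toFinite covers).exists_le_minimal h0
  have hwit : ∀ e ∈ F, ∃ S, IsWitness a b D X F e S := by
    intro e he
    by_contra! hno
    have : F.erase e ∈ covers := by
      intro S hS
      by_contra! h
      refine hno S ⟨hS, fun f hf => ⟨fun h' => ?_, ?_⟩⟩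
      · by_contra hfe
        exact h f (Finset.mem_erase.2 ⟨hfe, hf⟩) h'
      · rintro rfl
        obtain ⟨g, hg, hgS⟩ := hF.prop S hS
        by_cases hgf : g = f
        · exact hgf ▸ hgS
        · exact absurd hgS (h g (Finset.mem_erase.2 ⟨hgf, hg⟩))
    exact (Finset.erase_ssubset he).ne (hF.eq_of_le this (Finset.erase_subset _ _))
  have hFcard : F.card ≤ F'.card + 2 * 𝒜.card := by
    have hsub : F ⊆ F' ∪ F.filter fun e => ∃ A ∈ 𝒜, Crosses a b e A := by
      intro e he
      have := hFle he
      rw [Finset.mem_union, Set.mem_toFinset] at this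
      rw [Finset.mem_union, Finset.mem_filter]
      exact this.imp_right fun h => ⟨he, h.2⟩
    have h1 := (Finset.card_le_card hsub).trans (Finset.card_union_le _ _)
    have h2 := card_cover_crossing_le hF.prop hwit h𝒜
    omega
  have hno : ∀ A ∈ 𝒜, ∀ S ∈ ℛ, ∀ e, e ∉ D → Crosses a b e A → ¬ Crosses a b e S :=
    fun A hA S hS e he h => (hℛ S hS).1 e (Or.inr ⟨he, A, hA, h⟩)
  refine ⟨F, ℛ ∪ ℐ, fun e he => ?_, hF.prop, fun S hS => ?_, fun S hS T hT hST e he h => ?_, ?_⟩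
  · have := hFle he
    rw [Finset.mem_union, Set.mem_toFinset] at this
    exact this.elim (hF'D e) fun h => h.1
  · rcases Finset.mem_union.1 hS with hS | hS
    · exact ⟨fun e he => (hℛ S hS).1 e (Or.inl he), (hℛ S hS).2⟩
    · exact ((h𝒜 S).1 (hℐ𝒜 hS)).prop
  · rcases Finset.mem_union.1 hS with hS | hS <;> rcases Finset.mem_union.1 hT with hT | hT
    · exact hdisj S hS T hT hST e he h
    · exact hno T (hℐ𝒜 hT) S hS e he h.2 h.1
    · exact hno S (hℐ𝒜 hS) T hT e he h.1 h.2
    · exact hℐ S hS T hT hST e he h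
  · rw [Finset.card_union_of_disjoint]
    · omega
    · refine Finset.disjoint_left.2 fun S hS hSℐ => ?_
      obtain ⟨e, he, heS⟩ := hcross S ((h𝒜 S).1 (hℐ𝒜 hSℐ)).prop
      exact hno S (hℐ𝒜 hSℐ) S hS e he heS heS

end Packing

theorem isDCycle_iff {V ε : Type} [DecidableEq ε] {ends : ε → Sym2 V} {Dem C : Finset ε} :
    IsDCycle ends Dem C ↔
      IsCycle ends C ∧ ∃ d ∈ C, d ∈ Dem ∧ ∀ e ∈ C, e ∈ Dem → e = d := by
  refine and_congr_right fun _ => ?_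
  rw [Finset.card_eq_one]
  constructor
  · rintro ⟨d, hd⟩
    have hd' : d ∈ C ∩ Dem := hd ▸ Finset.mem_singleton_self d
    refine ⟨d, (Finset.mem_inter.1 hd').1, (Finset.mem_inter.1 hd').2, fun e h1 h2 => ?_⟩
    exact Finset.mem_singleton.1 (hd ▸ Finset.mem_inter.2 ⟨h1, h2⟩)
  · rintro ⟨d, h1, h2, h⟩
    exact ⟨d, Finset.eq_singleton_iff_unique_mem.2 ⟨Finset.mem_inter.2 ⟨h1, h2⟩,
      fun e he => h e (Finset.mem_inter.1 he).1 (Finset.mem_inter.1 he).2⟩⟩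

/-- Unit cuts of the dual graph contain `D`-cycles. -/
theorem exists_dCycle_of_mem_unitCuts {V ε Φ : Type} [Fintype V] [Fintype ε] [DecidableEq ε]
    {ends : ε → Sym2 V} {x y : ε → V} (hxy : ∀ e, ends e = s(x e, y e)) {a b : ε → Φ}
    (hdual : cycleSpace x y = LinearMap.range (cob a b)) {Dem : Finset ε} {S : Set Φ}
    (hS : S ∈ unitCuts a b (Dem : Set ε) ∅) :
    ∃ C, IsDCycle ends Dem C ∧ ∀ e ∈ C, Crosses a b e S := by
  obtain ⟨-, d, hd, hdS, hu⟩ := hS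
  have hne : ∀ e, cob a b (charVec S) e ≠ 0 ↔ Crosses a b e S := by
    intro e
    rw [cob_apply]
    by_cases h1 : a e ∈ S <;> by_cases h2 : b e ∈ S <;> simp [charVec, Crosses, h1, h2]
    decide
  obtain ⟨C, hC, hdC, hCS⟩ := exists_cycle_of_mem_cycleSpace hxy (d := d)
    (hdual ▸ LinearMap.mem_range_self (cob a b) (charVec S)) ((hne d).2 hdS)
  have hCS' : ∀ e ∈ C, Crosses a b e S := fun e he => (hne e).1 (hCS e he)
  exact ⟨C, isDCycle_iff.2 ⟨hC, d, hdC, hd, fun e he heD => hu e heD (hCS' e he)⟩, hCS'⟩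

/-- if `G+H` is planar (and connected), the minimum cardinality of a multicut
is at most `64` times the maximum value of an integer multiflow. -/
theorem stmt1 {V ε : Type} [Fintype V] [DecidableEq V] [Fintype ε] [DecidableEq ε]
    (ends : ε → Sym2 V) (Dem : Finset ε)
    (hplanar : IsPlanar ends) (hconn : MGConnected ends)
    (m : ℕ)
    (hmax : IsGreatest {k : ℕ | ∃ Cyc : Fin k → Finset ε,
        (∀ i, IsDCycle ends Dem (Cyc i)) ∧
        (∀ e : ε, e ∉ Dem → ∀ i j, e ∈ Cyc i → e ∈ Cyc j → i = j)} m) :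
    ∃ F : Finset ε, (∀ e ∈ F, e ∉ Dem) ∧
      (∀ C : Finset ε, IsDCycle ends Dem C → (C ∩ F).Nonempty) ∧
      F.card ≤ 64 * m := by
  obtain ⟨x, y, hxy⟩ := exists_endpoints ends
  have : Nonempty V := hconn.1.to_type
  obtain ⟨n, a, b, hn, hcut⟩ := hplanar.exists_dual hconn
  have hdual := cycleSpace_eq_range_cob hxy hn hcut
  have hD : ∀ S ∈ unitCuts a b (Dem : Set ε) ∅, ∃ e, e ∉ (Dem : Set ε) ∧ Crosses a b e S := by
    intro S hS
    by_contra! hno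
    obtain ⟨C, hC, hCS⟩ := exists_dCycle_of_mem_unitCuts hxy hdual hS
    have := hmax.2 (show m + 1 ∈ _ from ⟨fun _ => C, fun _ => hC,
      fun e he i _ hi _ => absurd (hCS e hi) (hno e he)⟩)
    omega
  obtain ⟨F, 𝒬, hFD, hF, h𝒬, hdisj, hcard⟩ := exists_cover_packing hdual hD ∅
  refine ⟨F, hFD, fun C hC => ?_, ?_⟩
  · obtain ⟨hC, d, hd, hdD, hu⟩ := isDCycle_iff.1 hC
    obtain ⟨S, hS⟩ := hcut C hC
    obtain ⟨e, he, heS⟩ := hF S ⟨by simp, d, hdD, (hS d).1 hd, fun e he h => hu e ((hS e).2 h) he⟩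
    exact ⟨e, Finset.mem_inter.2 ⟨(hS e).2 heS, he⟩⟩
  · choose! c hc hcS using fun S (hS : S ∈ 𝒬) =>
      exists_dCycle_of_mem_unitCuts hxy hdual (h𝒬 S hS)
    have := hmax.2 (show 𝒬.card ∈ _ from ⟨fun i => c (𝒬.equivFin.symm i),
      fun i => hc _ (𝒬.equivFin.symm i).2, fun e he i j hi hj => ?_⟩)
    · omega
    · by_contra hij
      exact hdisj _ (𝒬.equivFin.symm i).2 _ (𝒬.equivFin.symm j).2
        (fun h => hij (𝒬.equivFin.symm.injective (Subtype.ext h))) e he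
        ⟨hcS _ (𝒬.equivFin.symm i).2 e hi, hcS _ (𝒬.equivFin.symm j).2 e hj⟩

end
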